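/- arXiv:2206.09801 — 2 statements merged into one kernel-verified Lean document; each statement's English description precedes it below -/
import Mathlib

section
/- Let l > 3 be a prime with l ≡ 3 or 5 (mod 7), and let j ∈ 𝔽_l with j ≠ 0, j ≠ 1728, and J_l(j) = 0 (that is, j is a supersingular j-invariant in characteristic l). Then there are exactly 2 distinct monic irreducible cubic polynomials over 𝔽_l dividing the degree-24 polynomial G(x,j) ∈ 𝔽_l[x], and G(x,j) has no roots in 𝔽_l. -/
open Polynomial

/-- The supersingular polynomial `J_l(j)` of Deuring, evaluated at `j ∈ 𝔽_l`:
`j ≠ 0, 1728` is a supersingular `j`-invariant in characteristic `l > 3` iff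
`J_l(j) = 0`. -/
noncomputable def Jl (l : ℕ) [Fact (Nat.Prime l)] (j : ZMod l) : ZMod l :=
  let s : ℕ := ((1 - legendreSym l (-4)) / 2).toNat
  let n : ℕ := l / 12
  ∑ k ∈ Finset.range (n + 1),
    ((2 * n + s).choose (2 * k + s) : ZMod l) * ((2 * n - 2 * k).choose (n - k) : ZMod l)
      * (-432 : ZMod l) ^ (n - k) * (j - 1728) ^ k

/-- The degree-24 polynomial `G(x,j)`. -/
noncomputable def Gxj (l : ℕ) [Fact (Nat.Prime l)] (j : ZMod l) : Polynomial (ZMod l) :=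
  (X ^ 2 - X + 1) ^ 3 *
      (X ^ 6 + 229 * X ^ 5 + 270 * X ^ 4 - 1695 * X ^ 3 + 1430 * X ^ 2 - 235 * X + 1) ^ 3
    - C j * (X * (X - 1) * (X ^ 3 - 8 * X ^ 2 + 5 * X + 1) ^ 7)

/-! ### Part A: Hasse coefficients -/

lemma sum_eval_eq_neg_coeff (l : ℕ) [Fact (Nat.Prime l)] (p : (ZMod l)[X])
    (hp : p.natDegree < 2 * (l - 1)) :
    ∑ x : ZMod l, p.eval x = - p.coeff (l - 1) := by
  have hl : 2 ≤ l := (Fact.out : Nat.Prime l).two_le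
  simp_rw [Polynomial.eval_eq_sum_range' hp]
  rw [Finset.sum_comm]
  simp_rw [← Finset.mul_sum]
  rw [Finset.sum_eq_single (l - 1)]
  · have : ∑ x : ZMod l, x ^ (l - 1) = -1 := by
      have h1 : ∀ x : ZMod l, x ^ (l - 1) = if x = 0 then 0 else 1 := by
        intro x
        split_ifs with h
        · rw [h, zero_pow (by omega)]
        · exact ZMod.pow_card_sub_one_eq_one h
      simp_rw [h1]
      rw [Finset.sum_ite]
      simp [Finset.filter_ne', Finset.card_erase_of_mem, ZMod.card]
      rw [Nat.cast_sub (by omega)]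
      simp
    rw [this]; ring
  · intro i hi hne
    have : ∑ x : ZMod l, x ^ i = 0 := by
      rcases lt_or_gt_of_ne hne with h | h
      · exact FiniteField.sum_pow_lt_card_sub_one (ZMod l) i (by rw [ZMod.card]; exact h)
      · have hi' := Finset.mem_range.1 hi
        have h2 : ∀ x : ZMod l, x ^ i = x ^ (i - (l - 1)) := by
          intro x
          by_cases hx : x = 0
          · rw [hx, zero_pow (by omega), zero_pow (by omega)]
          · conv_lhs => rw [show i = (l - 1) + (i - (l - 1)) by omega, pow_add,
              ZMod.pow_card_sub_one_eq_one hx, one_mul]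
        simp_rw [h2]
        exact FiniteField.sum_pow_lt_card_sub_one (ZMod l) _ (by rw [ZMod.card]; omega)
    rw [this, mul_zero]
  · intro h
    exact absurd (Finset.mem_range.2 (by omega)) h

lemma coeff_comp_X_add_C_char {K : Type*} [Field K] (l : ℕ) [Fact (Nat.Prime l)] [CharP K l]
    (p : K[X]) (hp : p.natDegree < 2 * (l - 1)) (c : K) :
    (p.comp (X + C c)).coeff (l - 1) = p.coeff (l - 1) := by
  have hl : 2 ≤ l := (Fact.out : Nat.Prime l).two_le
  rw [← Polynomial.taylor_apply, Polynomial.taylor_coeff]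
  have h : hasseDeriv (l - 1) p = C (p.coeff (l - 1)) := by
    ext i
    rw [hasseDeriv_coeff, coeff_C]
    split_ifs with h
    · subst h; simp
    · by_cases hi : i + (l - 1) < 2 * (l - 1)
      · have : (((i + (l - 1)).choose (l - 1) : ℕ) : K) = 0 := by
          rw [CharP.cast_eq_zero_iff K l]
          have hpr : Nat.Prime l := Fact.out
          apply hpr.dvd_choose <;> omega
        rw [this, zero_mul]
      · rw [Polynomial.coeff_eq_zero_of_natDegree_lt (by omega), mul_zero]
  rw [h, eval_C]

/-- the monic cubic -/
noncomputable def cub {K : Type*} [CommRing K] (a b c : K) : K[X] :=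
  X ^ 3 + C a * X ^ 2 + C b * X + C c

lemma cub_natDegree {K : Type*} [Field K] (a b c : K) : (cub a b c).natDegree = 3 := by
  unfold cub; compute_degree!

lemma cub_monic {K : Type*} [Field K] (a b c : K) : (cub a b c).Monic := by
  unfold cub; monicity!

lemma cub_eval {K : Type*} [CommRing K] (a b c x : K) :
    (cub a b c).eval x = x ^ 3 + a * x ^ 2 + b * x + c := by
  simp [cub]

/-- Hasse coefficient -/
noncomputable def hcf {K : Type*} [CommRing K] (l : ℕ) (f : K[X]) : K :=
  (f ^ ((l - 1) / 2)).coeff (l - 1)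

lemma cub_pow_natDegree {K : Type*} [Field K] (l : ℕ) (hl : 3 < l) (a b c : K) :
    ((cub a b c) ^ ((l - 1) / 2)).natDegree < 2 * (l - 1) := by
  rw [natDegree_pow, cub_natDegree]; omega

lemma hcf_shift {K : Type*} [Field K] (l : ℕ) [Fact (Nat.Prime l)] [CharP K l] (hl : 3 < l)
    (a b c t : K) : hcf l ((cub a b c).comp (X + C t)) = hcf l (cub a b c) := by
  unfold hcf
  rw [← Polynomial.pow_comp, coeff_comp_X_add_C_char l _ (cub_pow_natDegree l hl a b c)]

lemma cub_comp {K : Type*} [Field K] (a b c t : K) : (cub a b c).comp (X + C t) =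
    cub (a + 3 * t) (b + 2 * a * t + 3 * t ^ 2) (c + b * t + a * t ^ 2 + t ^ 3) := by
  simp only [cub, add_comp, mul_comp, pow_comp, X_comp, C_comp, C_add, C_mul, C_pow]
  simp only [map_ofNat]
  ring

lemma hcf_map {K L : Type*} [Field K] [Field L] (φ : K →+* L) (l : ℕ) (f : K[X]) :
    hcf l (f.map φ) = φ (hcf l f) := by
  unfold hcf
  rw [← Polynomial.map_pow, coeff_map]

lemma hcf_nodal {K : Type*} [Field K] (l : ℕ) (hodd : l % 2 = 1) (c T : K) :
    hcf l (cub c 0 T) = ∑ e ∈ Finset.range ((l - 1) / 2 + 1),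
      (((l - 1) / 2).choose e * ((l - 1) / 2 - e).choose (2 * e) : ℕ)
        * c ^ ((l - 1) / 2 - 3 * e) * T ^ e := by
  unfold hcf
  obtain ⟨m, rfl⟩ : ∃ m, l = 2 * m + 1 := ⟨l / 2, by omega⟩
  have h1 : (2 * m + 1 - 1) / 2 = m := by omega
  have h2 : 2 * m + 1 - 1 = 2 * m := by omega
  rw [h1, h2]
  have h3 : cub c 0 T = C T + X ^ 2 * (X + C c) := by
    simp only [cub, C_0]; ring
  rw [h3, add_pow, finsetSum_coeff]
  apply Finset.sum_congr rfl
  intro e he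
  have he' : e ≤ m := by have := Finset.mem_range.1 he; omega
  rw [mul_pow, ← pow_mul, ← C_pow]
  rw [show C (T ^ e) * (X ^ (2 * (m - e)) * (X + C c) ^ (m - e)) * ((m.choose e : ℕ) : K[X])
    = C (T ^ e * (m.choose e : ℕ)) * ((X + C c) ^ (m - e) * X ^ (2 * (m - e))) by
      simp only [C_mul, map_natCast]; ring]
  rw [coeff_C_mul, show 2 * m = 2 * e + 2 * (m - e) by omega, coeff_mul_X_pow, coeff_X_add_C_pow]
  rw [show m - e - 2 * e = m - 3 * e by omega]
  push_cast; ring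

lemma legendre_coeff_one {K : Type*} [Field K] (N : ℕ) (q : K) :
    (((1 + C q * X : K[X]) * (1 + C (q + 1) * X)) ^ N).coeff N =
      ∑ e ∈ Finset.range (N + 1), (N.choose e * (N + e).choose e : ℕ) * q ^ e := by
  have h : ((1 + C q * X : K[X]) * (1 + C (q + 1) * X)) ^ N =
      ∑ e ∈ Finset.range (N + 1), C ((N.choose e : ℕ) : K) * ((C q * X + 1) ^ (N + e) * X ^ (N - e)) := by
    rw [mul_pow, show (1 + C (q + 1) * X : K[X]) = (C q * X + 1) + X by simp only [C_add, C_1]; ring,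
      add_pow (C q * X + 1) X, Finset.mul_sum]
    apply Finset.sum_congr rfl
    intro e _
    rw [pow_add]
    simp only [map_natCast]; ring
  rw [h, finsetSum_coeff]
  apply Finset.sum_congr rfl
  intro e he
  have he' : e ≤ N := by have := Finset.mem_range.1 he; omega
  rw [coeff_C_mul]
  conv_lhs => rw [show (((C q * X + 1) ^ (N + e) * X ^ (N - e) : K[X])).coeff N =
    (((C q * X + 1) ^ (N + e) * X ^ (N - e) : K[X])).coeff (e + (N - e)) by congr 1; omega]
  rw [coeff_mul_X_pow]
  have h2 : ((C q * X + 1 : K[X]) ^ (N + e)) = ((X + 1) ^ (N + e)).comp (C q * X) := by simp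
  rw [h2, comp_C_mul_X_coeff, coeff_X_add_one_pow]
  push_cast; ring

lemma legendre_coeff_two {K : Type*} [Field K] (N : ℕ) (q : K) :
    (((1 + C q * X : K[X]) * (1 + C (q + 1) * X)) ^ N).coeff N =
      ∑ i ∈ Finset.range (N + 1), (N.choose (2 * i) * (2 * i).choose i : ℕ) * (q * (q + 1)) ^ i *
        (2 * q + 1) ^ (N - 2 * i) := by
  have h : ((1 + C q * X : K[X]) * (1 + C (q + 1) * X)) ^ N =
      ∑ i ∈ Finset.range (N + 1), C (((N.choose i : ℕ) : K) * (q * (q + 1)) ^ i) *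
        ((C (2 * q + 1) * X + 1) ^ (N - i) * X ^ (2 * i)) := by
    rw [show (1 + C q * X : K[X]) * (1 + C (q + 1) * X) =
      C (q * (q + 1)) * X ^ 2 + (C (2 * q + 1) * X + 1) by
        simp only [C_add, C_mul, C_1, map_ofNat]; ring]
    rw [add_pow]
    apply Finset.sum_congr rfl
    intro e _
    rw [mul_pow, ← pow_mul]
    simp only [map_natCast, C_mul, C_pow]; ring
  rw [h, finsetSum_coeff]
  apply Finset.sum_congr rfl
  intro i hi
  have hi' : i ≤ N := by have := Finset.mem_range.1 hi; omega
  rw [coeff_C_mul]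
  by_cases h2i : 2 * i ≤ N
  · conv_lhs => rw [show (((C (2 * q + 1) * X + 1) ^ (N - i) * X ^ (2 * i) : K[X])).coeff N =
      (((C (2 * q + 1) * X + 1) ^ (N - i) * X ^ (2 * i) : K[X])).coeff ((N - 2 * i) + 2 * i) by
        congr 1; omega]
    rw [coeff_mul_X_pow]
    have h2 : ((C (2 * q + 1) * X + 1 : K[X]) ^ (N - i)) = ((X + 1) ^ (N - i)).comp (C (2 * q + 1) * X) := by
      simp
    rw [h2, comp_C_mul_X_coeff, coeff_X_add_one_pow]
    have h3 : N.choose (2 * i) * (2 * i).choose i = N.choose i * (N - i).choose (N - 2 * i) := by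
      rw [Nat.choose_mul (by omega)]
      congr 1
      rw [← Nat.choose_symm (by omega)]
      congr 1
      omega
    rw [h3]
    push_cast; ring
  · rw [coeff_mul_X_pow', if_neg (by omega), Nat.choose_eq_zero_of_lt (show N < 2 * i by omega)]
    simp

lemma choose_ratio {K : Type*} [Field K] (l : ℕ) [Fact (Nat.Prime l)] [CharP K l] (hl : 3 < l)
    (e : ℕ) (he : e ≤ l / 6) :
    (4 : K) ^ e * ((((l - 1) / 2).choose e * ((l - 1) / 2 - e).choose (2 * e) : ℕ) : K) =
      27 ^ e * (((l / 6).choose e * (l / 6 + e).choose e : ℕ) : K) := by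
  have hpr : Nat.Prime l := Fact.out
  set m := (l - 1) / 2 with hm
  set N := l / 6 with hN
  have hodd : l % 2 = 1 := by
    rcases hpr.eq_two_or_odd with h | h <;> omega
  have h3 : l % 3 ≠ 0 := by
    intro h
    have := (Nat.prime_dvd_prime_iff_eq Nat.prime_three hpr).1 (Nat.dvd_of_mod_eq_zero h)
    omega
  have hlK : (l : K) = 0 := CharP.cast_eq_zero K l
  have hmK : 2 * (m : K) + 1 = 0 := by
    have : 2 * m + 1 = l := by omega
    rw [← hlK, ← this]; push_cast; ring
  have hNK : 36 * ((N : K) ^ 2 + N) + 5 = 0 := by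
    have : 6 * N + 1 = l ∨ 6 * N + 5 = l := by omega
    rcases this with h | h
    · have : 6 * (N : K) + 1 = 0 := by rw [← hlK, ← h]; push_cast; ring
      linear_combination (6 * (N : K) + 5) * this
    · have : 6 * (N : K) + 5 = 0 := by rw [← hlK, ← h]; push_cast; ring
      linear_combination (6 * (N : K) + 1) * this
  have hne : ∀ k : ℕ, 0 < k → k < l → (k : K) ≠ 0 := by
    intro k h0 h1 h
    rw [CharP.cast_eq_zero_iff K l] at h
    exact absurd (Nat.le_of_dvd h0 h) (by omega)
  induction e with
  | zero => simp
  | succ e ih =>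
    have ih := ih (by omega)
    have h1 : (m.choose (e + 1) : K) * (e + 1) = m.choose e * (m - e) := by
      have := Nat.choose_succ_right_eq m e
      have h : ((m.choose (e + 1) * (e + 1) : ℕ) : K) = (m.choose e * (m - e) : ℕ) := by rw [this]
      push_cast [Nat.cast_sub (show e ≤ m by omega)] at h
      exact h
    -- ratio for the second binomial
    have h2 : ((m - (e + 1)).choose (2 * (e + 1)) : K) * ((m - e) * (2 * e + 1) * (2 * e + 2)) =
        ((m - e).choose (2 * e) : K) * ((m - 3 * e) * (m - 3 * e - 1) * (m - 3 * e - 2)) := by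
      obtain ⟨a, ha⟩ : ∃ a, m = a + 3 * e + 3 := ⟨m - 3 * e - 3, by omega⟩
      have e1 : m - (e + 1) = a + 2 * e + 2 := by omega
      have e2 : m - e = a + 2 * e + 3 := by omega
      have e3 : (m : K) = a + 3 * e + 3 := by rw [ha]; push_cast; ring
      rw [e1, e2, e3]
      have k1 : ((a + 2 * e + 3) * (a + 2 * e + 2).choose (2 * e + 2) : ℕ) =
        (a + 2 * e + 3).choose (2 * e + 2) * (a + 1) := by
        have := Nat.add_one_mul_choose_eq (a + 2 * e + 2) (2 * e + 2)
        have t := Nat.choose_succ_right_eq (a + 2 * e + 3) (2 * e + 2)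
        rw [show a + 2 * e + 3 - (2 * e + 2) = a + 1 by omega] at t
        rw [← t]
        exact this
      have k2 := Nat.choose_succ_right_eq (a + 2 * e + 3) (2 * e + 1)
      have k3 := Nat.choose_succ_right_eq (a + 2 * e + 3) (2 * e)
      rw [show a + 2 * e + 3 - (2 * e + 1) = a + 2 by omega] at k2
      rw [show a + 2 * e + 3 - (2 * e) = a + 3 by omega] at k3
      have k1' := congrArg (Nat.cast : ℕ → K) k1
      have k2' := congrArg (Nat.cast : ℕ → K) k2
      have k3' := congrArg (Nat.cast : ℕ → K) k3
      push_cast at k1' k2' k3'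
      rw [show 2 * (e + 1) = 2 * e + 2 by ring]
      rw [show 2 * e + 1 + 1 = 2 * e + 2 by ring] at k2'
      linear_combination (2 * (e : K) + 1) * (2 * e + 2) * k1' + (a + 1) * (2 * (e : K) + 1) * k2' +
        (a + 1) * (a + 2) * k3'
    have h4 : (N.choose (e + 1) : K) * (e + 1) = N.choose e * (N - e) := by
      have := Nat.choose_succ_right_eq N e
      have h : ((N.choose (e + 1) * (e + 1) : ℕ) : K) = (N.choose e * (N - e) : ℕ) := by rw [this]
      push_cast [Nat.cast_sub (show e ≤ N by omega)] at h
      exact h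
    have h5 : ((N + (e + 1)).choose (e + 1) : K) * (e + 1) = (N + e).choose e * (N + e + 1) := by
      have := Nat.add_one_mul_choose_eq (N + e) e
      have h := congrArg (Nat.cast : ℕ → K) this
      push_cast at h
      rw [show N + (e + 1) = N + e + 1 by ring]
      linear_combination -h
    have n1 : ((e : K) + 1) ≠ 0 := by exact_mod_cast hne (e + 1) (by omega) (by omega)
    have n2 : (2 * (e : K) + 1) ≠ 0 := by exact_mod_cast hne (2 * e + 1) (by omega) (by omega)
    have n3 : (2 * (e : K) + 2) ≠ 0 := by exact_mod_cast hne (2 * e + 2) (by omega) (by omega)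
    have n4 : ((m : K) - e) ≠ 0 := by
      have := hne (m - e) (by omega) (by omega)
      rwa [Nat.cast_sub (by omega)] at this
    have n5 : (2 : K) ≠ 0 := by exact_mod_cast hne 2 (by omega) (by omega)
    have n6 : (3 : K) ≠ 0 := by exact_mod_cast hne 3 (by omega) (by omega)
    have c1 : (m.choose (e + 1) : K) = m.choose e * (m - e) / (e + 1) := by
      rw [eq_div_iff n1, h1]
    have c2 : ((m - (e + 1)).choose (2 * (e + 1)) : K) = ((m - e).choose (2 * e) : K) *
        ((m - 3 * e) * (m - 3 * e - 1) * (m - 3 * e - 2)) / ((m - e) * (2 * e + 1) * (2 * e + 2)) := by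
      rw [eq_div_iff (mul_ne_zero (mul_ne_zero n4 n2) n3), h2]
    have c4 : (N.choose (e + 1) : K) = N.choose e * (N - e) / (e + 1) := by
      rw [eq_div_iff n1, h4]
    have c5 : ((N + (e + 1)).choose (e + 1) : K) = (N + e).choose e * (N + e + 1) / (e + 1) := by
      rw [eq_div_iff n1, h5]
    push_cast at ih ⊢
    rw [c1, c2, c4, c5]
    have hm' : (m : K) = -1 / 2 := by field_simp; linear_combination hmK
    have key : 4 * ((m - 3 * e) * (m - 3 * e - 1) * (m - 3 * e - 2)) * (e + 1) =
      27 * ((N : K) - e) * (N + e + 1) * ((2 * e + 1) * (2 * e + 2)) := by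
      have h8 : (N : K) ^ 2 + N = - 5 / 36 := by
        have : (36 : K) ≠ 0 := by
          rw [show (36 : K) = 2 * 2 * 3 * 3 by norm_num]
          simp [n5, n6]
        field_simp; linear_combination hNK
      have h9 : ((N : K) - e) * (N + e + 1) = - 5 / 36 - e ^ 2 - e := by
        rw [← h8]; ring
      rw [mul_assoc 27, h9, hm']
      have : (36 : K) ≠ 0 := by
          rw [show (36 : K) = 2 * 2 * 3 * 3 by norm_num]
          simp [n5, n6]
      field_simp
      ring
    have e1 : (4 : K) ^ (e + 1) * (m.choose e * (m - e) / (e + 1) * (((m - e).choose (2 * e) : K) *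
        ((m - 3 * e) * (m - 3 * e - 1) * (m - 3 * e - 2)) / ((m - e) * (2 * e + 1) * (2 * e + 2)))) =
        (4 ^ e * (m.choose e * ((m - e).choose (2 * e) : K))) *
        (4 * ((m - 3 * e) * (m - 3 * e - 1) * (m - 3 * e - 2)) / ((e + 1) * ((2 * e + 1) * (2 * e + 2)))) := by
      field_simp
      ring
    have e2 : (27 : K) ^ (e + 1) * (N.choose e * (N - e) / (e + 1) * ((N + e).choose e * (N + e + 1) / (e + 1))) =
        (27 ^ e * (N.choose e * (N + e).choose e)) * (27 * ((N : K) - e) * (N + e + 1) / ((e + 1) * (e + 1))) := by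
      field_simp
      ring
    rw [e1, e2, ih]
    congr 1
    rw [div_eq_div_iff (mul_ne_zero n1 (mul_ne_zero n2 n3)) (mul_ne_zero n1 n1)]
    linear_combination ((e : K) + 1) * key

lemma s_eq (l : ℕ) [Fact (Nat.Prime l)] (hl : 3 < l) :
    2 * (l / 12) + ((1 - legendreSym l (-4)) / 2).toNat = l / 6 := by
  have hpr : Nat.Prime l := Fact.out
  have hodd : l % 2 = 1 := by
    rcases hpr.eq_two_or_odd with h | h <;> omega
  have h3 : l % 3 ≠ 0 := by
    intro h
    have := (Nat.prime_dvd_prime_iff_eq Nat.prime_three hpr).1 (Nat.dvd_of_mod_eq_zero h)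
    omega
  have h1 : legendreSym l (-4) = legendreSym l (-1) := by
    rw [show (-4 : ℤ) = -1 * 2 ^ 2 by norm_num, legendreSym.mul, legendreSym.sq_one' l, mul_one]
    intro h
    have : ((2 : ℕ) : ZMod l) = 0 := by exact_mod_cast h
    rw [ZMod.natCast_eq_zero_iff] at this
    have := Nat.le_of_dvd (by norm_num) this
    omega
  rw [h1, legendreSym.at_neg_one (by omega)]
  have h4 : l % 4 = 1 ∨ l % 4 = 3 := by omega
  rcases h4 with h | h
  · rw [ZMod.χ₄_nat_one_mod_four h]
    have : l % 12 = 1 ∨ l % 12 = 5 := by omega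
    simp; omega
  · rw [ZMod.χ₄_nat_three_mod_four h]
    have : l % 12 = 7 ∨ l % 12 = 11 := by omega
    simp; omega

lemma hcf_zero_of_Jl_aux (K : Type*) [Field K] [IsAlgClosed K] (l : ℕ) [Fact (Nat.Prime l)] (hl : 3 < l) (j A B : ZMod l) (hA : A ≠ 0)
    (φ : ZMod l →+* K) (hj0 : j ≠ 0) (hj : j ≠ 1728) (hj' : 1728 * (4 * A ^ 3) = j * (4 * A ^ 3 + 27 * B ^ 2))
    (hss : Jl l j = 0) : hcf l (cub 0 A B) = 0 := by
  have hpr : Nat.Prime l := Fact.out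
  have hodd : l % 2 = 1 := by
    rcases hpr.eq_two_or_odd with h | h <;> omega
  have hφ : Function.Injective φ := φ.injective
  have : CharP K l := charP_of_injective_ringHom hφ l
  have hne : ∀ k : ℕ, 0 < k → k < l → (k : K) ≠ 0 := by
    intro k h0 h1 h
    rw [CharP.cast_eq_zero_iff K l] at h
    exact absurd (Nat.le_of_dvd h0 h) (by omega)
  have n2 : (2 : K) ≠ 0 := by exact_mod_cast hne 2 (by omega) (by omega)
  have n3 : (3 : K) ≠ 0 := by exact_mod_cast hne 3 (by omega) (by omega)
  have n4 : (4 : K) ≠ 0 := by rw [show (4 : K) = 2 * 2 by norm_num]; exact mul_ne_zero n2 n2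
  have n27 : (27 : K) ≠ 0 := by
    rw [show (27 : K) = 3 * 3 * 3 by norm_num]; exact mul_ne_zero (mul_ne_zero n3 n3) n3
  apply hφ
  rw [map_zero, ← hcf_map]
  obtain ⟨a, ha⟩ := IsAlgClosed.exists_pow_nat_eq (-(φ A) / 3) (n := 2) (by norm_num)
  have hA' : φ A = -3 * a ^ 2 := by rw [ha]; field_simp
  have hAK : φ A ≠ 0 := by rwa [ne_eq, map_eq_zero]
  have ha0 : a ≠ 0 := by
    rintro rfl
    apply hAK; rw [hA']; ring
  set b := φ B with hb
  set i := φ j with hi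
  have hi0 : i ≠ 0 := by rwa [hi, ne_eq, map_eq_zero]
  have hi1 : i - 1728 ≠ 0 := by
    intro h
    apply hj
    apply hφ
    rw [map_ofNat]
    linear_combination h
  have hj2 : 1728 * (4 * (φ A) ^ 3) = i * (4 * (φ A) ^ 3 + 27 * b ^ 2) := by
    have := congrArg φ hj'
    simpa only [map_mul, map_add, map_pow, map_ofNat] using this
  rw [hA'] at hj2
  have hmap : (cub 0 A B).map φ = cub 0 (-3 * a ^ 2) b := by
    simp [cub, ← hA', hb]
  rw [hmap, ← hcf_shift l hl _ _ _ a, cub_comp]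
  rw [show (-3 * a ^ 2 + 2 * 0 * a + 3 * a ^ 2 : K) = 0 by ring, hcf_nodal l hodd]
  set q := (b - 2 * a ^ 3) / (4 * a ^ 3) with hq
  have hT : b + -3 * a ^ 2 * a + 0 * a ^ 2 + a ^ 3 = 4 * a ^ 3 * q := by
    rw [hq]; field_simp; ring
  rw [hT]
  have hN : l / 6 ≤ (l - 1) / 2 := by omega
  have h3l : l % 3 ≠ 0 := by
    intro h
    have := (Nat.prime_dvd_prime_iff_eq Nat.prime_three hpr).1 (Nat.dvd_of_mod_eq_zero h)
    omega
  have hstep : ∑ e ∈ Finset.range ((l - 1) / 2 + 1),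
      (((l - 1) / 2).choose e * ((l - 1) / 2 - e).choose (2 * e) : ℕ)
        * (0 + 3 * a) ^ ((l - 1) / 2 - 3 * e) * (4 * a ^ 3 * q) ^ e =
      (3 * a) ^ ((l - 1) / 2) * ∑ e ∈ Finset.range (l / 6 + 1),
        ((l / 6).choose e * (l / 6 + e).choose e : ℕ) * q ^ e := by
    rw [← Finset.sum_subset (Finset.range_subset_range.2 (show l / 6 + 1 ≤ (l - 1) / 2 + 1 by omega))]
    · rw [Finset.mul_sum]
      apply Finset.sum_congr rfl
      intro e he
      have he' : e ≤ l / 6 := by have := Finset.mem_range.1 he; omega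
      have h := choose_ratio (K := K) l hl e he'
      have h3 : (3 * a) ^ ((l - 1) / 2) = (3 * a) ^ ((l - 1) / 2 - 3 * e) * (27 ^ e * a ^ (3 * e)) := by
        rw [show (27 : K) = 3 ^ 3 by norm_num, ← pow_mul, ← mul_pow, ← pow_add]
        congr 1; omega
      rw [h3, zero_add, mul_pow (4 * a ^ 3), mul_pow 4, ← pow_mul]
      linear_combination (3 * a) ^ ((l - 1) / 2 - 3 * e) * a ^ (3 * e) * q ^ e * h
    · intro e he hne
      have he' : ¬ e < l / 6 + 1 := fun h => hne (Finset.mem_range.2 h)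
      rw [Nat.choose_eq_zero_of_lt (show (l - 1) / 2 - e < 2 * e by omega)]
      simp
  rw [hstep, ← legendre_coeff_one, legendre_coeff_two]
  apply mul_eq_zero_of_right
  -- now compare with J
  set s : ℕ := ((1 - legendreSym l (-4)) / 2).toNat with hs
  set n : ℕ := l / 12 with hn
  have hNs : l / 6 = 2 * n + s := (s_eq l hl).symm
  have hs1 : s ≤ 1 := by omega
  rw [hNs]
  have hJ : φ (Jl l j) = ∑ k ∈ Finset.range (n + 1),
    ((2 * n + s).choose (2 * k + s) : K) * ((2 * n - 2 * k).choose (n - k) : K)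
      * (-432 : K) ^ (n - k) * (i - 1728) ^ k := by
    unfold Jl
    simp only [map_sum, map_mul, map_pow, map_natCast, map_sub, map_neg, map_ofNat]
    rfl
  rw [hss, map_zero] at hJ
  have hx2 : (2 * q + 1) ^ 2 * i = i - 1728 := by
    have : (2 * q + 1) = b / (2 * a ^ 3) := by rw [hq]; field_simp; ring
    rw [this]
    field_simp
    have h27 : (27 : K) * (b ^ 2 * i) = 27 * (2 ^ 2 * a ^ 6 * (i - 1728)) := by
      linear_combination -hj2
    have := mul_left_cancel₀ n27 h27
    linear_combination this
  have hqq : q * (q + 1) * i = -432 := by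
    have : 4 * (q * (q + 1) * i) = 4 * (-432) := by linear_combination hx2
    exact mul_left_cancel₀ n4 this
  have hin : i ^ n ≠ 0 := pow_ne_zero _ hi0
  apply (mul_eq_zero.1 (?_ : i ^ n * _ = 0)).resolve_left hin
  rw [← Finset.sum_subset (Finset.range_subset_range.2 (show n + 1 ≤ 2 * n + s + 1 by omega))]
  · rw [← Finset.sum_range_reflect] at hJ
    rw [Finset.mul_sum, show (0 : K) = (2 * q + 1) ^ s * 0 by ring, hJ, Finset.mul_sum]
    apply Finset.sum_congr rfl
    intro k hk
    have hk' : k ≤ n := by have := Finset.mem_range.1 hk; omega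
    rw [show n + 1 - 1 - k = n - k by omega, show n - (n - k) = k by omega,
      show 2 * n - 2 * (n - k) = 2 * k by omega,
      show 2 * (n - k) + s = 2 * n + s - 2 * k by omega,
      Nat.choose_symm (by omega)]
    rw [← hx2, ← hqq, show 2 * n + s - 2 * k = s + 2 * (n - k) by omega, pow_add, pow_mul,
      show i ^ n = i ^ k * i ^ (n - k) by rw [← pow_add]; congr 1; omega]
    rw [mul_pow (q * (q + 1)), mul_pow ((2 * q + 1) ^ 2)]
    push_cast
    ring
  · intro e he hne
    have he' : ¬ e < n + 1 := fun h => hne (Finset.mem_range.2 h)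
    rw [Nat.choose_eq_zero_of_lt (show 2 * n + s < 2 * e by omega)]
    simp

lemma hcf_zero_of_Jl (l : ℕ) [Fact (Nat.Prime l)] (hl : 3 < l) (j A B : ZMod l) (hA : A ≠ 0)
    (hj0 : j ≠ 0) (hj : j ≠ 1728) (hj' : 1728 * (4 * A ^ 3) = j * (4 * A ^ 3 + 27 * B ^ 2))
    (hss : Jl l j = 0) : hcf l (cub 0 A B) = 0 :=
  hcf_zero_of_Jl_aux (AlgebraicClosure (ZMod l)) l hl j A B hA
    (algebraMap (ZMod l) (AlgebraicClosure (ZMod l))) hj0 hj hj' hss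

lemma quadChar_cast (l : ℕ) [Fact (Nat.Prime l)] (hl : 3 < l) (x : ZMod l) :
    ((quadraticChar (ZMod l) x : ℤ) : ZMod l) = x ^ ((l - 1) / 2) := by
  have hpr : Nat.Prime l := Fact.out
  have hodd : l % 2 = 1 := by
    rcases hpr.eq_two_or_odd with h | h <;> omega
  have hc : ringChar (ZMod l) ≠ 2 := by rw [ZMod.ringChar_zmod_n]; omega
  rw [quadraticChar_eq_pow_of_char_ne_two' hc, ZMod.card]
  congr 1; omega

lemma not_all_eq (l : ℕ) [Fact (Nat.Prime l)] (hl : 3 < l) (a b c ε : ZMod l) (hε : ε ≠ 0)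
    (h : ∀ x, (cub a b c).eval x ^ ((l - 1) / 2) = ε) : False := by
  have hpr : Nat.Prime l := Fact.out
  have hodd : l % 2 = 1 := by
    rcases hpr.eq_two_or_odd with h | h <;> omega
  set f := cub a b c with hf
  set m := (l - 1) / 2 with hm
  have hfd : f.natDegree = 3 := cub_natDegree a b c
  have hf0 : f ≠ 0 := (cub_monic a b c).ne_zero
  have hdvd : (X ^ l - X : (ZMod l)[X]) ∣ f ^ m - C ε := by
    have h1 : (X ^ l - X : (ZMod l)[X]) = ∏ x : ZMod l, (X - C x) := by
      have hr := FiniteField.roots_X_pow_card_sub_X (ZMod l)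
      rw [ZMod.card] at hr
      have hmon : (X ^ l - X : (ZMod l)[X]).Monic :=
        monic_X_pow_sub (by rw [degree_X]; exact_mod_cast (by omega : 1 < l))
      have hd : (X ^ l - X : (ZMod l)[X]).natDegree = l :=
        FiniteField.X_pow_card_sub_X_natDegree_eq _ (by omega)
      have := prod_multiset_X_sub_C_of_monic_of_roots_card_eq hmon (by
        rw [hr, hd]; simp [ZMod.card])
      rw [hr] at this
      exact this.symm
    rw [h1]
    apply Finset.prod_dvd_of_coprime
    · intro x _ y _ hxy
      exact isCoprime_X_sub_C_of_isUnit_sub (sub_ne_zero.2 hxy).isUnit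
    · intro x _
      rw [dvd_iff_isRoot]
      simp [h x]
  obtain ⟨g, hg⟩ := hdvd
  have hlK : ((l : ℕ) : (ZMod l)[X]) = 0 := CharP.cast_eq_zero _ l
  have hm1 : 1 ≤ m := by omega
  have hder : C (m : ZMod l) * f ^ (m - 1) * derivative f = - g + (X ^ l - X) * derivative g := by
    have := congrArg derivative hg
    rw [derivative_mul, derivative_sub, derivative_sub, derivative_C, derivative_pow, derivative_X,
      derivative_X_pow] at this
    simp only [map_natCast, hlK] at this ⊢
    linear_combination this
  have hfm : f ^ m = f ^ (m - 1) * f := by rw [← pow_succ]; congr 1; omega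
  have hkey : C ((m : ZMod l) * ε) * derivative f + f * g =
      (X ^ l - X) * (f * derivative g - C (m : ZMod l) * derivative f * g) := by
    rw [C_mul]
    linear_combination f * hder - C (m : ZMod l) * derivative f * hg
      + C (m : ZMod l) * derivative f * hfm
  have hdX : (X ^ l - X : (ZMod l)[X]).natDegree = l := FiniteField.X_pow_card_sub_X_natDegree_eq _ (by omega)
  have hX0 : (X ^ l - X : (ZMod l)[X]) ≠ 0 := by
    intro h; rw [h] at hdX; simp at hdX; omega
  have hfd' : (derivative f).natDegree ≤ 2 := by
    have := natDegree_derivative_le f; omega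
  have hgd : g.natDegree + l ≤ 3 * m := by
    by_cases hg0 : g = 0
    · rw [hg0]; simp; omega
    have := natDegree_mul hX0 hg0
    rw [← hg, hdX] at this
    have h2 : (f ^ m - C ε).natDegree ≤ 3 * m := by
      rw [natDegree_sub_C, natDegree_pow, hfd]; omega
    omega
  have hz : f * derivative g - C (m : ZMod l) * derivative f * g = 0 := by
    by_contra hne
    have h1 := natDegree_mul hX0 hne
    rw [← hkey, hdX] at h1
    have h2 : (C ((m : ZMod l) * ε) * derivative f + f * g).natDegree ≤ 3 + g.natDegree := by
      apply (natDegree_add_le _ _).trans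
      apply max_le
      · exact (natDegree_C_mul_le _ _).trans (by omega)
      · exact natDegree_mul_le.trans (by omega)
    omega
  rw [hz, mul_zero] at hkey
  have hdf : f ∣ C ((m : ZMod l) * ε) * derivative f := ⟨-g, by linear_combination hkey⟩
  have h0 : C ((m : ZMod l) * ε) * derivative f = 0 := by
    apply eq_zero_of_dvd_of_natDegree_lt hdf
    rw [hfd]
    exact lt_of_le_of_lt (natDegree_C_mul_le _ _) (by omega)
  have hnat : ∀ k : ℕ, 0 < k → k < l → (k : ZMod l) ≠ 0 := by
    intro k h0 h1 h
    rw [ZMod.natCast_eq_zero_iff] at h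
    exact absurd (Nat.le_of_dvd h0 h) (by omega)
  have hc := congrArg (fun p => coeff p 2) h0
  simp only [coeff_C_mul, coeff_zero, coeff_derivative] at hc
  have hc3 : f.coeff (2 + 1) = 1 := by
    have := (cub_monic a b c).coeff_natDegree
    rwa [cub_natDegree] at this
  rw [hc3] at hc
  have h3 : (3 : ZMod l) ≠ 0 := by exact_mod_cast hnat 3 (by omega) (by omega)
  have hmm := hnat m (by omega) (by omega)
  have : (m : ZMod l) * ε * 3 = 0 := by push_cast at hc; linear_combination hc
  exact (mul_ne_zero (mul_ne_zero hmm hε) h3) this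

lemma charsum_zero (l : ℕ) [Fact (Nat.Prime l)] (hl : 3 < l) (a b c : ZMod l)
    (h : hcf l (cub a b c) = 0) :
    ∑ x : ZMod l, quadraticChar (ZMod l) ((cub a b c).eval x) = 0 := by
  set S := ∑ x : ZMod l, quadraticChar (ZMod l) ((cub a b c).eval x) with hS
  have hcast : (S : ZMod l) = 0 := by
    rw [hS, Int.cast_sum]
    simp_rw [quadChar_cast l hl, ← eval_pow]
    rw [sum_eval_eq_neg_coeff l _ (cub_pow_natDegree l hl a b c)]
    unfold hcf at h
    rw [h, neg_zero]
  have hdvd : (l : ℤ) ∣ S := (ZMod.intCast_zmod_eq_zero_iff_dvd S l).1 hcast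
  have hb : ∀ x : ZMod l, -1 ≤ quadraticChar (ZMod l) x ∧ quadraticChar (ZMod l) x ≤ 1 := by
    intro x
    by_cases hx : x = 0
    · rw [hx]; simp
    · rcases quadraticChar_dichotomy hx with h | h <;> rw [h] <;> norm_num
  have key : ∀ ε : ℤ, (ε = 1 ∨ ε = -1) → S ≠ ε * l := by
    intro ε hε hSe
    have hall : ∀ x : ZMod l, quadraticChar (ZMod l) ((cub a b c).eval x) = ε := by
      have hsum : ∑ x : ZMod l, (1 - ε * quadraticChar (ZMod l) ((cub a b c).eval x)) = 0 := by
        rw [Finset.sum_sub_distrib, ← Finset.mul_sum, ← hS, hSe]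
        simp [ZMod.card]
        rcases hε with rfl | rfl <;> ring
      rw [Finset.sum_eq_zero_iff_of_nonneg] at hsum
      · intro x
        have := hsum x (Finset.mem_univ x)
        rcases hε with rfl | rfl <;> linarith
      · intro x _
        have := hb ((cub a b c).eval x)
        rcases hε with rfl | rfl <;> linarith
    apply not_all_eq l hl a b c (ε : ZMod l)
    · rcases hε with rfl | rfl <;> simp
    · intro x
      rw [← quadChar_cast l hl, hall]
  have hle : |S| ≤ l := by
    rw [abs_le]
    constructor
    · have : ∑ x : ZMod l, (-1 : ℤ) ≤ S := Finset.sum_le_sum fun x _ => (hb _).1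
      simpa [ZMod.card] using this
    · have : S ≤ ∑ x : ZMod l, (1 : ℤ) := Finset.sum_le_sum fun x _ => (hb _).2
      simpa [ZMod.card] using this
  obtain ⟨k, hk⟩ := hdvd
  have hl0 : (0 : ℤ) < l := by omega
  rw [hk, abs_mul, abs_of_pos hl0] at hle
  have hk1 : |k| ≤ 1 := by nlinarith
  rw [abs_le] at hk1
  have : k = 0 ∨ k = 1 ∨ k = -1 := by omega
  rcases this with h | h | h
  · rw [hk, h, mul_zero]
  · exact absurd (by rw [hk, h]; ring) (key 1 (Or.inl rfl))
  · exact absurd (by rw [hk, h]; ring) (key (-1) (Or.inr rfl))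

lemma hom_aux1 {K : Type*} [Field K] (u v a b c : K) (hv : v ≠ 0) :
    u ^ 3 + a * u ^ 2 * v ^ 2 + b * u * v ^ 4 + c * v ^ 6 =
      v ^ 6 * ((u / v ^ 2) ^ 3 + a * (u / v ^ 2) ^ 2 + b * (u / v ^ 2) + c) := by
  field_simp

lemma hom_aux2 {K : Type*} [Field K] (a u w z : K) (hz : z ≠ 0) :
    a * u * w = w * z * (a * (u / z)) := by
  field_simp

/-- invariance of the vanishing of the Hasse coefficient under a normalised isogeny -/
lemma hcf_isogeny (l : ℕ) [Fact (Nat.Prime l)] (hl : 3 < l) (a b c a' b' c' : ZMod l)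
    (U V : (ZMod l)[X]) (hW : derivative U * V - 2 * U * derivative V ≠ 0)
    (hid : U ^ 3 + C a' * U ^ 2 * V ^ 2 + C b' * U * V ^ 4 + C c' * V ^ 6 =
      cub a b c * (derivative U * V - 2 * U * derivative V) ^ 2)
    (h : hcf l (cub a' b' c') = 0) : hcf l (cub a b c) = 0 := by
  have hpr : Nat.Prime l := Fact.out
  have hodd : l % 2 = 1 := by
    rcases hpr.eq_two_or_odd with h | h <;> omega
  set W := derivative U * V - 2 * U * derivative V with hWdef
  set m := (l - 1) / 2 with hm
  set g := (cub a' b' c') ^ m with hg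
  set F := (cub a b c) ^ m with hF
  have hgdeg : g.natDegree = 3 * m := by rw [hg, natDegree_pow, cub_natDegree]; ring
  have hFdeg : F.natDegree = 3 * m := by rw [hF, natDegree_pow, cub_natDegree]; ring
  have hlK : ((l : ℕ) : (ZMod l)[X]) = 0 := CharP.cast_eq_zero _ l
  -- homogenisation
  have hhom : ∑ k ∈ Finset.range (3 * m + 1), C (g.coeff k) * U ^ k * V ^ (6 * m - 2 * k) =
      (U ^ 3 + C a' * U ^ 2 * V ^ 2 + C b' * U * V ^ 4 + C c' * V ^ 6) ^ m := by
    by_cases hV : V = 0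
    · subst hV
      rw [Finset.sum_eq_single (3 * m)]
      · have : g.coeff (3 * m) = 1 := by
          have := ((cub_monic a' b' c').pow m).coeff_natDegree
          rwa [← hg, hgdeg] at this
        rw [this]
        simp [show 6 * m - 2 * (3 * m) = 0 by omega, pow_mul]
      · intro k hk hne
        have := Finset.mem_range.1 hk
        rw [zero_pow (by omega), mul_zero]
      · intro h; exact absurd (Finset.mem_range.2 (by omega)) h
    · let Q := FractionRing (ZMod l)[X]
      have hinj : Function.Injective (algebraMap (ZMod l)[X] Q) := IsFractionRing.injective _ _
      apply hinj
      set u := algebraMap (ZMod l)[X] Q U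
      set v := algebraMap (ZMod l)[X] Q V with hv
      have hv0 : v ≠ 0 := by
        rw [hv]; exact (map_ne_zero_iff _ hinj).2 hV
      have hev : aeval (u / v ^ 2) g = (aeval (u / v ^ 2) (cub a' b' c')) ^ m := by
        rw [hg, map_pow]
      rw [aeval_eq_sum_range, hgdeg] at hev
      have e1 : algebraMap (ZMod l)[X] Q
          (U ^ 3 + C a' * U ^ 2 * V ^ 2 + C b' * U * V ^ 4 + C c' * V ^ 6) =
          v ^ 6 * aeval (u / v ^ 2) (cub a' b' c') := by
        simp only [cub, map_add, map_mul, map_pow, aeval_X, aeval_C]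
        have hC : ∀ x : ZMod l, algebraMap (ZMod l)[X] Q (C x) = algebraMap (ZMod l) Q x := by
          intro x; rfl
        simp only [hC]
        exact hom_aux1 _ _ _ _ _ hv0
      rw [map_pow, e1, mul_pow, ← hev, Finset.mul_sum, map_sum]
      apply Finset.sum_congr rfl
      intro k hk
      have hk' : k ≤ 3 * m := by have := Finset.mem_range.1 hk; omega
      have hC : algebraMap (ZMod l)[X] Q (C (g.coeff k)) = algebraMap (ZMod l) Q (g.coeff k) := rfl
      rw [map_mul, map_mul, map_pow, map_pow, hC, Algebra.smul_def]
      change algebraMap (ZMod l) Q (g.coeff k) * u ^ k * v ^ (6 * m - 2 * k) = _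
      have : (v ^ 6) ^ m = v ^ (6 * m - 2 * k) * v ^ (2 * k) := by
        rw [← pow_mul, ← pow_add]; congr 1; omega
      rw [this, div_pow, ← pow_mul]
      exact hom_aux2 _ _ _ _ (pow_ne_zero _ hv0)
  have hnat : ∀ k : ℕ, 0 < k → k < l → (k : ZMod l) ≠ 0 := by
    intro k h0 h1 h
    rw [ZMod.natCast_eq_zero_iff] at h
    exact absurd (Nat.le_of_dvd h0 h) (by omega)
  -- F * W ^ l is a derivative
  have hderiv : ∃ Q : (ZMod l)[X], F * W ^ l = derivative Q := by
    have e1 : F * W ^ l = ∑ k ∈ Finset.range (3 * m + 1),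
        C (g.coeff k) * (U ^ k * V ^ (6 * m - 2 * k) * W) := by
      have : W ^ l = (W ^ 2) ^ m * W := by
        rw [← pow_mul, ← pow_succ]; congr 1; omega
      rw [this, hF, ← mul_assoc, ← mul_pow, ← hid, ← hhom, Finset.sum_mul]
      apply Finset.sum_congr rfl
      intro k _; ring
    refine ⟨∑ k ∈ Finset.range (3 * m + 1),
      C (g.coeff k * ((k + 1 : ℕ) : ZMod l)⁻¹) * (U ^ (k + 1) * V ^ (6 * m - 2 * k + 1)), ?_⟩
    rw [e1, derivative_sum]
    apply Finset.sum_congr rfl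
    intro k hk
    have hk' : k ≤ 3 * m := by have := Finset.mem_range.1 hk; omega
    by_cases hkl : k = l - 1
    · have : g.coeff k = 0 := by rw [hkl]; exact h
      rw [this]; simp
    · have hne : ((k + 1 : ℕ) : ZMod l) ≠ 0 := by
        intro h0
        rw [ZMod.natCast_eq_zero_iff] at h0
        obtain ⟨r, hr⟩ := h0
        have h1 : r < 2 := by
          by_contra h2
          have : l * 2 ≤ l * r := Nat.mul_le_mul_left l (by omega)
          omega
        interval_cases r <;> omega
      rw [derivative_C_mul, derivative_mul, derivative_pow, derivative_pow]
      have hexp : ((6 * m - 2 * k + 1 : ℕ) : (ZMod l)[X]) = -2 * ((k + 1 : ℕ) : (ZMod l)[X]) := by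
        have : ((6 * m - 2 * k + 1 + 2 * (k + 1) : ℕ) : (ZMod l)[X]) = 0 := by
          rw [show 6 * m - 2 * k + 1 + 2 * (k + 1) = 3 * l by omega]
          push_cast [hlK]; ring
        push_cast at this ⊢
        linear_combination this
      have hC1 : C (g.coeff k * ((k + 1 : ℕ) : ZMod l)⁻¹) * ((k + 1 : ℕ) : (ZMod l)[X]) = C (g.coeff k) := by
        rw [← map_natCast C, ← C_mul]
        congr 1
        field_simp
      rw [map_natCast, map_natCast, hexp, Nat.add_sub_cancel, Nat.add_sub_cancel, hWdef, ← hC1]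
      ring
  obtain ⟨Q, hQ⟩ := hderiv
  -- compare coefficients
  set i := W.natDegree with hi
  have hc : (F * W ^ l).coeff (i * l + (l - 1)) = 0 := by
    rw [hQ, coeff_derivative]
    have : ((i * l + (l - 1) : ℕ) : ZMod l) + 1 = 0 := by
      have : ((i * l + (l - 1) + 1 : ℕ) : ZMod l) = 0 := by
        rw [show i * l + (l - 1) + 1 = (i + 1) * l by rw [add_mul]; omega]
        simp
      exact_mod_cast this
    rw [this, mul_zero]
  rw [← ZMod.expand_card] at hc
  have hW2 : expand (ZMod l) l W = C W.leadingCoeff * X ^ (i * l) + expand (ZMod l) l W.eraseLead := by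
    conv_lhs => rw [← W.eraseLead_add_C_mul_X_pow]
    rw [map_add, map_mul, expand_C, map_pow, expand_X, ← pow_mul, mul_comm l]
    ring
  rw [hW2, mul_add, coeff_add] at hc
  have hz : (F * expand (ZMod l) l W.eraseLead).coeff (i * l + (l - 1)) = 0 := by
    by_cases h0 : W.eraseLead = 0
    · rw [h0]; simp
    · apply coeff_eq_zero_of_natDegree_lt
      apply lt_of_le_of_lt natDegree_mul_le
      rw [hFdeg, natDegree_expand]
      have hlt : W.eraseLead.natDegree + 1 ≤ i := by
        have := (eraseLead_natDegree_lt_or_eraseLead_eq_zero W).resolve_right h0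
        omega
      have := Nat.mul_le_mul_right l hlt
      rw [add_mul] at this
      omega
  rw [hz, add_zero, ← mul_assoc, mul_comm F, mul_assoc, coeff_C_mul, add_comm (i * l)] at hc
  rw [coeff_mul_X_pow] at hc
  exact (mul_eq_zero.1 hc).resolve_left (leadingCoeff_ne_zero.2 hW)

/-- resultant-type form -/
def Rr {R : Type*} [CommRing R] (A B a b c : R) : R :=
  a^3*B^2 - a^2*b*A*B + a^2*c*A^2 + 3*a*b*c*B - 2*A*a*c^2 - b^3*B + b^2*c*A + c^3

def RR {R : Type*} [CommRing R] (A B : R) (g : R × R × R) : R :=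
  -Rr A B g.1 (g.2.1 - A) (g.2.2 - B)

def sy3 {R : Type*} [CommRing R] (t : R × R × R) : R × R × R :=
  (-(t.1 + t.2.1 + t.2.2), t.1 * t.2.1 + t.2.1 * t.2.2 + t.2.2 * t.1, -(t.1 * t.2.1 * t.2.2))

def sy2 {R : Type*} [CommRing R] (t : R × R × R) : R × R × R :=
  (t.2.1 - t.1, t.2.2 - t.1 * t.2.1, -(t.1 * t.2.2))

def RQ {R : Type*} [CommRing R] (A B u v : R) : R :=
  (u^2 - v + A)^2 * v - (u^2 - v + A) * (u * v + B) * u + (u * v + B)^2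

lemma RR_sy3 {R : Type*} [CommRing R] (A B : R) (t : R × R × R) :
    RR A B (sy3 t) = (t.1^3 + A * t.1 + B) * (t.2.1^3 + A * t.2.1 + B) * (t.2.2^3 + A * t.2.2 + B) := by
  obtain ⟨x, y, z⟩ := t
  simp only [RR, sy3, Rr]; ring

lemma RR_sy2 {R : Type*} [CommRing R] (A B : R) (t : R × R × R) :
    RR A B (sy2 t) = (t.1^3 + A * t.1 + B) * RQ A B t.2.1 t.2.2 := by
  obtain ⟨x, y, z⟩ := t
  simp only [RR, sy2, Rr, RQ]; ring

/-- an irreducible cubic has a root in the cubic extension -/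
lemma cubic_root_K (l : ℕ) [Fact (Nat.Prime l)] {K : Type*} [Field K] [Fintype K]
    [Algebra (ZMod l) K] (hK : Fintype.card K = l ^ 3) (p : (ZMod l)[X]) (hp : Irreducible p)
    (hd : p.natDegree = 3) : ∃ x : K, aeval x p = 0 := by
  have h1 : p ∣ X ^ (Nat.card (ZMod l)) ^ 3 - X :=
    (hp.natDegree_dvd_iff_dvd_X_pow_card_pow_sub_X).1 (by rw [hd])
  rw [Nat.card_zmod, ← hK] at h1
  have hs := FiniteField.splits_X_pow_card_sub_X (K := K) (l)
  have hne : (X ^ Fintype.card K - X : (ZMod l)[X]) ≠ 0 :=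
    FiniteField.X_pow_card_sub_X_ne_zero _ Fintype.one_lt_card
  have hs' : (p.map (algebraMap (ZMod l) K)).Splits := by
    refine Splits.of_dvd (hs) ?_ (Polynomial.map_dvd _ h1)
    exact (Polynomial.map_ne_zero hne)
  obtain ⟨x, hx⟩ := hs'.exists_eval_eq_zero (by
    rw [degree_map]; rw [degree_eq_natDegree hp.ne_zero, hd]; decide)
  exact ⟨x, by rwa [eval_map_algebraMap] at hx⟩

lemma cubic_irred (l : ℕ) [Fact (Nat.Prime l)] (a b c : ZMod l)
    (h : ∀ x, (cub a b c).eval x ≠ 0) : Irreducible (cub a b c) := by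
  rw [(cub_monic a b c).irreducible_iff_roots_eq_zero_of_degree_le_three
    (by rw [cub_natDegree]; omega) (by rw [cub_natDegree])]
  rw [Multiset.eq_zero_iff_forall_notMem]
  intro x hx
  exact h x (isRoot_of_mem_roots hx)

lemma cub_root_K (l : ℕ) [Fact (Nat.Prime l)] {K : Type*} [Field K] [Fintype K]
    [Algebra (ZMod l) K] (hK : Fintype.card K = l ^ 3) (a b c : ZMod l) :
    ∃ x : K, aeval x (cub a b c) = 0 := by
  by_cases h : ∀ x, (cub a b c).eval x ≠ 0
  · exact cubic_root_K l hK _ (cubic_irred l a b c h) (cub_natDegree a b c)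
  · push Not at h
    obtain ⟨x, hx⟩ := h
    refine ⟨algebraMap _ K x, ?_⟩
    rw [aeval_algebraMap_apply]
    simp [hx]

lemma mem_range_of_pow (l : ℕ) [Fact (Nat.Prime l)] {K : Type*} [Field K] 
    [Algebra (ZMod l) K] (x : K) (hx : x ^ l = x) : ∃ a : ZMod l, algebraMap (ZMod l) K a = x := by
  have : CharP K l := charP_of_injective_algebraMap (algebraMap (ZMod l) K).injective l
  have h := (Subfield.mem_bot_iff_pow_eq_self (F := K) (p := l)).2 hx
  rw [← ZMod.fieldRange_castHom_eq_bot l] at h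
  obtain ⟨a, ha⟩ := h
  refine ⟨a, ?_⟩
  rw [← ha]
  congr 1
  exact Subsingleton.elim _ _

lemma quadChar_norm (l : ℕ) [Fact (Nat.Prime l)] (hl : 3 < l) {K : Type*} [Field K] [Fintype K]
    [DecidableEq K] [Algebra (ZMod l) K] (hK : Fintype.card K = l ^ 3) (a : ZMod l) (x : K)
    (h : algebraMap (ZMod l) K a = x * x ^ l * x ^ (l ^ 2)) :
    quadraticChar K x = quadraticChar (ZMod l) a := by
  have hpr : Nat.Prime l := Fact.out
  have hodd : l % 2 = 1 := by
    rcases hpr.eq_two_or_odd with h | h <;> omega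
  have hch : CharP K l := charP_of_injective_algebraMap (algebraMap (ZMod l) K).injective l
  have hc : ringChar (ZMod l) ≠ 2 := by rw [ZMod.ringChar_zmod_n]; omega
  have hcK : ringChar K ≠ 2 := by rw [ringChar.eq K l]; omega
  have h1 := quadraticChar_eq_pow_of_char_ne_two' hc a
  have h2 := quadraticChar_eq_pow_of_char_ne_two' hcK x
  rw [ZMod.card] at h1
  have h3 := congrArg (algebraMap (ZMod l) K) h1
  rw [map_intCast, map_pow, h] at h3
  have hexp : Fintype.card K / 2 = (1 + l + l ^ 2) * (l / 2) := by
    rw [hK]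
    obtain ⟨k, hk⟩ : ∃ k, l = 2 * k + 1 := ⟨l / 2, by omega⟩
    have e : l ^ 3 = 2 * ((1 + l + l ^ 2) * (l / 2)) + 1 := by
      rw [show l / 2 = k by omega, hk]; ring
    omega
  have h4 : ((quadraticChar K x : ℤ) : K) = ((quadraticChar (ZMod l) a : ℤ) : K) := by
    rw [h2, h3, hexp, pow_mul]; congr 1; ring
  have hl2 : ∀ n : ℤ, |n| ≤ 2 → (n : K) = 0 → n = 0 := by
    intro n hn h0
    rw [CharP.intCast_eq_zero_iff K l] at h0
    by_contra hne
    have := Int.le_of_dvd (abs_pos.2 hne) ((dvd_abs _ _).2 h0)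
    omega
  have hb1 : |quadraticChar K x| ≤ 1 := by
    by_cases hx : x = 0
    · rw [hx]; simp
    · rcases quadraticChar_dichotomy hx with h | h <;> rw [h] <;> norm_num
  have hb2 : |quadraticChar (ZMod l) a| ≤ 1 := by
    by_cases hx : a = 0
    · rw [hx]; simp
    · rcases quadraticChar_dichotomy hx with h | h <;> rw [h] <;> norm_num
  have := hl2 (quadraticChar K x - quadraticChar (ZMod l) a)
    (by rw [abs_le] at *; constructor <;> linarith) (by push_cast; rw [h4, sub_self])
  linarith

lemma exists_sym (l : ℕ) [Fact (Nat.Prime l)] {K : Type*} [Field K] [Fintype K]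
    [Algebra (ZMod l) K] (hK : Fintype.card K = l ^ 3) (x : K) :
    ∃ g : ZMod l × ZMod l × ZMod l,
      (algebraMap (ZMod l) K g.1, algebraMap (ZMod l) K g.2.1, algebraMap (ZMod l) K g.2.2) =
        sy3 (x, x ^ l, x ^ (l ^ 2)) := by
  have hch : CharP K l := charP_of_injective_algebraMap (algebraMap (ZMod l) K).injective l
  have hx : (x ^ (l ^ 2)) ^ l = x := by
    rw [← pow_mul, ← pow_succ, ← hK]; exact FiniteField.pow_card x
  have hx2 : (x ^ l) ^ l = x ^ (l ^ 2) := by rw [← pow_mul, sq]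
  obtain ⟨a, ha⟩ := mem_range_of_pow l (x + x ^ l + x ^ (l ^ 2))
    (by rw [add_pow_char, add_pow_char, hx, hx2]; ring)
  obtain ⟨b, hb⟩ := mem_range_of_pow l (x * x ^ l + x ^ l * x ^ (l ^ 2) + x ^ (l ^ 2) * x)
    (by rw [add_pow_char, add_pow_char, mul_pow, mul_pow, mul_pow, hx, hx2]; ring)
  obtain ⟨c, hc⟩ := mem_range_of_pow l (x * x ^ l * x ^ (l ^ 2))
    (by rw [mul_pow, mul_pow, hx, hx2]; ring)
  exact ⟨(-a, b, -c), by simp [sy3, ha, hb, hc]⟩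

lemma sy3_fib {F : Type*} [Field F] (x y z p q r : F) : sy3 (p, q, r) = sy3 (x, y, z) ↔
    (p = x ∧ q = y ∧ r = z) ∨ (p = x ∧ q = z ∧ r = y) ∨ (p = y ∧ q = x ∧ r = z) ∨
    (p = y ∧ q = z ∧ r = x) ∨ (p = z ∧ q = x ∧ r = y) ∨ (p = z ∧ q = y ∧ r = x) := by
  simp only [sy3, Prod.mk.injEq]
  constructor
  · rintro ⟨h1, h2, h3⟩
    have hp : (p - x) * (p - y) * (p - z) = 0 := by
      linear_combination (-p^2) * h1 - p * h2 - h3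
    rw [mul_eq_zero, mul_eq_zero, sub_eq_zero, sub_eq_zero, sub_eq_zero] at hp
    have quad : ∀ s t : F, q + r = s + t → q * r = s * t →
        (q = s ∧ r = t) ∨ (q = t ∧ r = s) := by
      intro s t h h'
      have : (q - s) * (q - t) = 0 := by linear_combination q * h - h'
      rcases mul_eq_zero.1 this with e | e
      · left; have e := sub_eq_zero.1 e; exact ⟨e, by rw [e] at h; exact add_left_cancel h⟩
      · right; have e := sub_eq_zero.1 e
        exact ⟨e, by rw [e, add_comm s] at h; exact add_left_cancel h⟩
    rcases hp with (hp | hp) | hp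
    · rw [hp] at h1 h2
      have := quad y z (by linear_combination -h1) (by linear_combination h2 + x * h1)
      clear h1 h2 h3 quad
      tauto
    · rw [hp] at h1 h2
      have := quad x z (by linear_combination -h1) (by linear_combination h2 + y * h1)
      clear h1 h2 h3 quad
      tauto
    · rw [hp] at h1 h2
      have := quad x y (by linear_combination -h1) (by linear_combination h2 + z * h1)
      clear h1 h2 h3 quad
      tauto
  · rintro (⟨rfl, rfl, rfl⟩ | ⟨rfl, rfl, rfl⟩ | ⟨rfl, rfl, rfl⟩ | ⟨rfl, rfl, rfl⟩ |
      ⟨rfl, rfl, rfl⟩ | ⟨rfl, rfl, rfl⟩) <;> refine ⟨by ring, by ring, by ring⟩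

lemma card_aux {F : Type*} [DecidableEq F] (x0 y z : F) (htrip : ¬ (y = x0 ∧ z = x0)) :
    (∅ : Finset F).card + 3 * ({x0, y, z} : Finset F).card = 3 +
    ({(x0, y, z), (x0, z, y), (y, x0, z), (y, z, x0), (z, x0, y), (z, y, x0)} :
      Finset (F × F × F)).card := by
  by_cases e1 : y = x0
  · subst e1
    have e2 : z ≠ y := fun h => htrip ⟨rfl, h⟩
    simp [Finset.card_insert_of_notMem, e2, e2.symm]
  · by_cases e2 : z = x0
    · subst e2
      simp [Finset.card_insert_of_notMem, e1, Ne.symm e1]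
    · by_cases e3 : y = z
      · subst e3
        simp [Finset.card_insert_of_notMem, e1, Ne.symm e1]
      · simp [Finset.card_insert_of_notMem, e1, Ne.symm e1, e2, Ne.symm e2, e3, Ne.symm e3]

lemma weight (l : ℕ) [Fact (Nat.Prime l)] (hl : 3 < l) {K : Type*} [Field K] [Fintype K]
    [DecidableEq K] [Algebra (ZMod l) K] (hK : Fintype.card K = l ^ 3)
    (S : K → ZMod l × ZMod l × ZMod l)
    (hS : ∀ x, (algebraMap (ZMod l) K (S x).1, algebraMap (ZMod l) K (S x).2.1,
      algebraMap (ZMod l) K (S x).2.2) = sy3 (x, x ^ l, x ^ (l ^ 2)))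
    (g : ZMod l × ZMod l × ZMod l) :
    (Finset.univ.filter fun x : K => S x = g).card +
      3 * (Finset.univ.filter fun t : ZMod l × ZMod l × ZMod l => sy2 t = g).card =
    3 + (Finset.univ.filter fun t : ZMod l × ZMod l × ZMod l => sy3 t = g).card := by
  obtain ⟨a, b, c⟩ := g
  have hch : CharP K l := charP_of_injective_algebraMap (algebraMap (ZMod l) K).injective l
  have hinj : Function.Injective (algebraMap (ZMod l) K) := (algebraMap (ZMod l) K).injective
  have hx3 : ∀ x : K, (x ^ (l ^ 2)) ^ l = x := by
    intro x
    rw [← pow_mul, ← pow_succ, ← hK]; exact FiniteField.pow_card x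
  have hx2 : ∀ x : K, (x ^ l) ^ l = x ^ (l ^ 2) := by intro x; rw [← pow_mul, sq]
  have hxl : ∀ x : ZMod l, (algebraMap (ZMod l) K x) ^ l = algebraMap (ZMod l) K x := by
    intro x; rw [← map_pow, ZMod.pow_card]
  have hlinj : ∀ x y : K, x ^ l = y ^ l → x = y := by
    intro x y h
    have : (x ^ (l^2)) ^ l = (y ^ (l^2)) ^ l := by
      rw [← pow_mul, ← pow_mul, mul_comm, pow_mul, h, ← pow_mul]
    rwa [hx3, hx3] at this
  have hSg : ∀ x : K, S x = (a, b, c) ↔ (algebraMap (ZMod l) K a, algebraMap (ZMod l) K b,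
      algebraMap (ZMod l) K c) = sy3 (x, x ^ l, x ^ (l ^ 2)) := by
    intro x
    rw [← hS x]
    constructor
    · intro h; rw [h]
    · intro h
      simp only [Prod.mk.injEq] at h
      ext
      · exact hinj h.1.symm
      · exact hinj h.2.1.symm
      · exact hinj h.2.2.symm
  have hfac : ∀ x y : K, (algebraMap (ZMod l) K a, algebraMap (ZMod l) K b,
      algebraMap (ZMod l) K c) = sy3 (x, x ^ l, x ^ (l ^ 2)) →
      y ^ 3 + algebraMap (ZMod l) K a * y ^ 2 + algebraMap (ZMod l) K b * y + algebraMap (ZMod l) K c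
        = (y - x) * (y - x ^ l) * (y - x ^ (l ^ 2)) := by
    intro x y h
    simp only [sy3, Prod.mk.injEq] at h
    obtain ⟨h1, h2, h3⟩ := h
    rw [h1, h2, h3]; ring
  by_cases hroot : ∀ x, (cub a b c).eval x ≠ 0
  · -- irreducible case
    obtain ⟨x, hx⟩ := cub_root_K l (K := K) hK a b c
    have hx' : x ^ 3 + algebraMap (ZMod l) K a * x ^ 2 + algebraMap (ZMod l) K b * x +
        algebraMap (ZMod l) K c = 0 := by
      simpa [cub] using hx
    have hxF : x ^ l ≠ x := by
      intro h
      obtain ⟨y, hy⟩ := mem_range_of_pow l x h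
      apply hroot y
      rw [cub_eval]
      apply hinj
      rw [← hy] at hx'
      simpa using hx'
    have hxy : x ^ (l ^ 2) ≠ x := by
      intro h
      apply hxF
      conv_lhs => rw [← h]
      exact hx3 x
    have hyz : x ^ l ≠ x ^ (l ^ 2) := by
      intro h
      rw [← hx2] at h
      exact hxF (hlinj _ _ h).symm
    have hfr : ∀ y : K, y ^ 3 + algebraMap (ZMod l) K a * y ^ 2 + algebraMap (ZMod l) K b * y +
        algebraMap (ZMod l) K c = 0 → (y ^ l) ^ 3 + algebraMap (ZMod l) K a * (y ^ l) ^ 2 +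
        algebraMap (ZMod l) K b * (y ^ l) + algebraMap (ZMod l) K c = 0 := by
      intro y hy
      have := congrArg (· ^ l) hy
      simp only [add_pow_char, mul_pow, hxl] at this
      rw [zero_pow (Fact.out : Nat.Prime l).ne_zero] at this
      rw [← this]; ring
    have hx1 := hfr _ hx'
    have hx22 := hfr _ hx1
    rw [hx2] at hx22
    have hsym : (algebraMap (ZMod l) K a, algebraMap (ZMod l) K b,
      algebraMap (ZMod l) K c) = sy3 (x, x ^ l, x ^ (l ^ 2)) := by
      generalize x ^ (l ^ 2) = z at *
      generalize x ^ l = y at *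
      generalize algebraMap (ZMod l) K a = a' at *
      generalize algebraMap (ZMod l) K b = b' at *
      generalize algebraMap (ZMod l) K c = c' at *
      have e1 : (y - x) * (y^2 + x * y + x^2 + a' * (x + y) + b') = 0 := by
        linear_combination hx1 - hx'
      have e2 : (z - x) * (z^2 + x * z + x^2 + a' * (x + z) + b') = 0 := by
        linear_combination hx22 - hx'
      have e1' := (mul_eq_zero.1 e1).resolve_left (sub_ne_zero.2 hxF)
      have e2' := (mul_eq_zero.1 e2).resolve_left (sub_ne_zero.2 hxy)
      have e3 : (y - z) * (x + y + z + a') = 0 := by linear_combination e1' - e2'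
      have e3' := (mul_eq_zero.1 e3).resolve_left (sub_ne_zero.2 hyz)
      simp only [sy3, Prod.mk.injEq]
      have ha : a' = -(x + y + z) := by linear_combination e3'
      have hb : b' = x * y + y * z + z * x := by rw [ha] at e1'; linear_combination e1'
      refine ⟨ha, hb, ?_⟩
      rw [ha, hb] at hx'; linear_combination hx'
    have h1 : (Finset.univ.filter fun x : K => S x = (a, b, c)) = {x, x ^ l, x ^ (l ^ 2)} := by
      ext y
      simp only [Finset.mem_filter, Finset.mem_univ, true_and, Finset.mem_insert,
        Finset.mem_singleton]
      constructor
      · intro h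
        have := hfac _ y hsym
        rw [hfac y y ((hSg y).1 h)] at this
        rw [sub_self, zero_mul, zero_mul, eq_comm, mul_eq_zero, mul_eq_zero, sub_eq_zero,
          sub_eq_zero, sub_eq_zero] at this
        tauto
      · rintro (h | h | h)
        · rw [h, hSg, hsym]
        · rw [h, hSg, hsym]
          have : (x ^ l) ^ (l ^ 2) = x := by rw [← pow_mul, mul_comm, pow_mul, hx3]
          rw [hx2, this]
          simp only [sy3, Prod.mk.injEq]
          refine ⟨by ring, by ring, by ring⟩
        · rw [h, hSg, hsym]
          have : (x ^ (l^2)) ^ (l ^ 2) = x ^ l := by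
            rw [show (x ^ (l^2)) ^ (l ^ 2) = ((x ^ (l ^ 2)) ^ l) ^ l by
              rw [← pow_mul (x ^ l^2) l l, sq], hx3]
          rw [hx3, this]
          simp only [sy3, Prod.mk.injEq]
          refine ⟨by ring, by ring, by ring⟩
    have h2 : (Finset.univ.filter fun t : ZMod l × ZMod l × ZMod l => sy2 t = (a, b, c)) = ∅ := by
      apply Finset.filter_eq_empty_iff.2
      rintro ⟨y, u, v⟩ _ h
      simp only [sy2, Prod.mk.injEq] at h
      obtain ⟨ha, hb, hc⟩ := h
      apply hroot y
      rw [cub_eval, ← ha, ← hb, ← hc]; ring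
    have h3 : (Finset.univ.filter fun t : ZMod l × ZMod l × ZMod l => sy3 t = (a, b, c)) = ∅ := by
      apply Finset.filter_eq_empty_iff.2
      rintro ⟨y, u, v⟩ _ h
      simp only [sy3, Prod.mk.injEq] at h
      obtain ⟨ha, hb, hc⟩ := h
      apply hroot y
      rw [cub_eval, ← ha, ← hb, ← hc]; ring
    rw [h1, h2, h3, Finset.card_eq_three.2 ⟨_, _, _, hxF.symm, hxy.symm, hyz, rfl⟩]
    simp
  · push Not at hroot
    obtain ⟨x0, hx0⟩ := hroot
    rw [cub_eval] at hx0
    -- every x in the first set equals x0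
    have hN : ∀ x : K, S x = (a, b, c) ↔ x = algebraMap (ZMod l) K x0 ∧
        (a, b, c) = sy3 (x0, x0, x0) := by
      intro x
      rw [hSg]
      constructor
      · intro h
        have h1 := hfac x (algebraMap (ZMod l) K x0) h
        have h2 : (algebraMap (ZMod l) K x0) ^ 3 + algebraMap (ZMod l) K a *
          (algebraMap (ZMod l) K x0) ^ 2 + algebraMap (ZMod l) K b * (algebraMap (ZMod l) K x0) +
            algebraMap (ZMod l) K c = 0 := by
          rw [← map_pow, ← map_pow, ← map_mul, ← map_mul, ← map_add, ← map_add, ← map_add, hx0,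
            map_zero]
        have hx : x = algebraMap (ZMod l) K x0 := by
          rw [h2, eq_comm, mul_eq_zero, mul_eq_zero, sub_eq_zero,
            sub_eq_zero, sub_eq_zero] at h1
          rcases h1 with (h1 | h1) | h1
          · exact h1.symm
          · apply hlinj; rw [← h1, hxl]
          · apply hlinj; apply hlinj; rw [hx2, ← h1, hxl, hxl]
        refine ⟨hx, ?_⟩
        rw [hx, ← hx2, hxl, hxl] at h
        simp only [sy3, Prod.mk.injEq] at h ⊢
        refine ⟨hinj ?_, hinj ?_, hinj ?_⟩
        · rw [h.1]; simp
        · rw [h.2.1]; simp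
        · rw [h.2.2]; simp
      · rintro ⟨hx, h⟩
        rw [hx, ← hx2, hxl, hxl]
        simp only [sy3, Prod.mk.injEq] at h ⊢
        rw [h.1, h.2.1, h.2.2]; simp
    -- description of sy2 fibre
    have h2 : ∀ t : ZMod l × ZMod l × ZMod l, sy2 t = (a, b, c) ↔
        (t.1 ^ 3 + a * t.1 ^ 2 + b * t.1 + c = 0 ∧ t.2.1 = a + t.1 ∧
          t.2.2 = b + t.1 * (a + t.1)) := by
      rintro ⟨y, u, v⟩
      simp only [sy2, Prod.mk.injEq]
      constructor
      · rintro ⟨ha, hb, hc⟩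
        refine ⟨by rw [← ha, ← hb, ← hc]; ring, by rw [← ha]; ring, by rw [← ha, ← hb]; ring⟩
      · rintro ⟨h1, h2, h3⟩
        refine ⟨by rw [h2]; ring, by rw [h2, h3]; ring, by rw [h3]; linear_combination -h1⟩
    have h2c : (Finset.univ.filter fun t : ZMod l × ZMod l × ZMod l => sy2 t = (a, b, c)).card =
        (Finset.univ.filter fun y : ZMod l => y ^ 3 + a * y ^ 2 + b * y + c = 0).card := by
      apply Finset.card_bij (fun t _ => t.1)
      · intro t ht
        simp only [Finset.mem_filter, Finset.mem_univ, true_and, h2] at ht ⊢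
        exact ht.1
      · intro t ht s hs hts
        simp only [Finset.mem_filter, Finset.mem_univ, true_and, h2] at ht hs
        ext
        · exact hts
        · rw [ht.2.1, hs.2.1, hts]
        · rw [ht.2.2, hs.2.2, hts]
      · intro y hy
        simp only [Finset.mem_filter, Finset.mem_univ, true_and] at hy
        exact ⟨(y, a + y, b + y * (a + y)), by
          simp only [Finset.mem_filter, Finset.mem_univ, true_and, h2]; simpa using hy, rfl⟩
    rw [h2c]
    by_cases hq : ∃ y : ZMod l, y ^ 2 + (a + x0) * y + (b + x0 * (a + x0)) = 0
    · obtain ⟨y, hy⟩ := hq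
      obtain ⟨z, hz⟩ : ∃ z, z = -(a + x0) - y := ⟨_, rfl⟩
      have ha : a = -(x0 + y + z) := by rw [hz]; ring
      have hb : b = x0 * y + y * z + z * x0 := by rw [hz]; linear_combination hy
      have hc : c = -(x0 * y * z) := by rw [ha, hb] at hx0; linear_combination hx0
      have hr : (Finset.univ.filter fun y : ZMod l => y ^ 3 + a * y ^ 2 + b * y + c = 0) =
          {x0, y, z} := by
        ext w
        simp only [Finset.mem_filter, Finset.mem_univ, true_and, Finset.mem_insert,
          Finset.mem_singleton]
        have : w ^ 3 + a * w ^ 2 + b * w + c = (w - x0) * (w - y) * (w - z) := by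
          rw [ha, hb, hc]; ring
        rw [this, mul_eq_zero, mul_eq_zero, sub_eq_zero, sub_eq_zero, sub_eq_zero]
        tauto
      have ht : (Finset.univ.filter fun t : ZMod l × ZMod l × ZMod l => sy3 t = (a, b, c)) =
          {(x0, y, z), (x0, z, y), (y, x0, z), (y, z, x0), (z, x0, y), (z, y, x0)} := by
        have hg : ((a, b, c) : ZMod l × ZMod l × ZMod l) = sy3 (x0, y, z) := by
          simp only [sy3, Prod.mk.injEq]; exact ⟨ha, hb, hc⟩
        ext ⟨p, q, r⟩
        rw [hg]
        simp only [Finset.mem_filter, Finset.mem_univ, true_and, Finset.mem_insert,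
          Finset.mem_singleton, Prod.mk.injEq, sy3_fib]
      rw [hr, ht]
      by_cases htrip : y = x0 ∧ z = x0
      · obtain ⟨rfl, rfl⟩ := htrip
        have : (Finset.univ.filter fun x : K => S x = (a, b, c)) = {algebraMap (ZMod l) K z} := by
          ext x
          simp only [Finset.mem_filter, Finset.mem_univ, true_and, Finset.mem_singleton, hN]
          constructor
          · exact fun h => h.1
          · intro h
            refine ⟨h, ?_⟩
            simp only [sy3, Prod.mk.injEq]
            exact ⟨ha, hb, hc⟩
        rw [this]; simp
      · have h0 : (Finset.univ.filter fun x : K => S x = (a, b, c)) = ∅ := by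
          apply Finset.filter_eq_empty_iff.2
          intro x _ h
          obtain ⟨-, h⟩ := (hN x).1 h
          apply htrip
          simp only [sy3, Prod.mk.injEq] at h
          obtain ⟨h1, h2, h3⟩ := h
          rw [ha] at h1; rw [hb] at h2; rw [hc] at h3
          have hy : (y - x0) ^ 3 = 0 := by
            linear_combination -y ^ 2 * h1 - y * h2 - h3
          have hz : (z - x0) ^ 3 = 0 := by
            linear_combination -z ^ 2 * h1 - z * h2 - h3
          exact ⟨sub_eq_zero.1 (pow_eq_zero_iff (by norm_num) |>.1 hy),
            sub_eq_zero.1 (pow_eq_zero_iff (by norm_num) |>.1 hz)⟩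
        rw [h0]
        exact card_aux x0 y z htrip
    · push Not at hq
      have h0 : (Finset.univ.filter fun x : K => S x = (a, b, c)) = ∅ := by
        apply Finset.filter_eq_empty_iff.2
        intro x _ h
        obtain ⟨-, h⟩ := (hN x).1 h
        simp only [sy3, Prod.mk.injEq] at h
        apply hq x0
        rw [h.1, h.2.1]; ring
      have hr : (Finset.univ.filter fun y : ZMod l => y ^ 3 + a * y ^ 2 + b * y + c = 0) = {x0} := by
        ext w
        simp only [Finset.mem_filter, Finset.mem_univ, true_and, Finset.mem_singleton]
        have : w ^ 3 + a * w ^ 2 + b * w + c = (w - x0) * (w ^ 2 + (a + x0) * w + (b + x0 * (a + x0))) := by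
          linear_combination hx0
        rw [this, mul_eq_zero, sub_eq_zero]
        have := hq w
        tauto
      have ht : (Finset.univ.filter fun t : ZMod l × ZMod l × ZMod l => sy3 t = (a, b, c)) = ∅ := by
        apply Finset.filter_eq_empty_iff.2
        rintro ⟨p, q, r⟩ _ h
        simp only [sy3, Prod.mk.injEq] at h
        obtain ⟨h1, h2, h3⟩ := h
        have : (x0 - p) * (x0 - q) * (x0 - r) = 0 := by
          rw [← h1, ← h2, ← h3] at hx0; linear_combination hx0
        rcases mul_eq_zero.1 this with h | h
        · rcases mul_eq_zero.1 h with h | h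
          · have h := sub_eq_zero.1 h
            apply hq q; rw [← h1, ← h2, h]; ring
          · have h := sub_eq_zero.1 h
            apply hq p; rw [← h1, ← h2, h]; ring
        · have h := sub_eq_zero.1 h
          apply hq p; rw [← h1, ← h2, h]; ring
      rw [h0, hr, ht]; simp

lemma S3_zero (l : ℕ) [Fact (Nat.Prime l)] (hl : 3 < l) {K : Type*} [Field K] [Fintype K]
    [DecidableEq K] [Algebra (ZMod l) K] (hK : Fintype.card K = l ^ 3) (A B : ZMod l)
    (h : ∑ x : ZMod l, quadraticChar (ZMod l) (x ^ 3 + A * x + B) = 0) :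
    ∑ x : K, quadraticChar K (x ^ 3 + algebraMap (ZMod l) K A * x + algebraMap (ZMod l) K B) = 0 := by
  choose S hS using exists_sym l (K := K) hK
  have hch : CharP K l := charP_of_injective_algebraMap (algebraMap (ZMod l) K).injective l
  have hc : ringChar (ZMod l) ≠ 2 := by rw [ZMod.ringChar_zmod_n]; omega
  set φ : ZMod l × ZMod l × ZMod l → ℤ := fun g => quadraticChar (ZMod l) (RR A B g) with hφ
  -- total sum vanishes
  have hc3 : ∑ g, φ g = 0 := by
    obtain ⟨ν, hν⟩ := quadraticChar_exists_neg_one hc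
    have hν0 : ν ≠ 0 := by rintro rfl; simp at hν
    let e : ZMod l × ZMod l × ZMod l ≃ ZMod l × ZMod l × ZMod l :=
      { toFun := fun g => (ν * g.1, A + ν * (g.2.1 - A), B + ν * (g.2.2 - B))
        invFun := fun g => (ν⁻¹ * g.1, A + ν⁻¹ * (g.2.1 - A), B + ν⁻¹ * (g.2.2 - B))
        left_inv := by
          rintro ⟨a, b, c⟩
          simp only [Prod.mk.injEq]
          refine ⟨by field_simp, by field_simp; ring, by field_simp; ring⟩
        right_inv := by
          rintro ⟨a, b, c⟩
          simp only [Prod.mk.injEq]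
          refine ⟨by field_simp, by field_simp; ring, by field_simp; ring⟩ }
    have h1 : ∑ g, φ (e g) = ∑ g, φ g := Equiv.sum_comp e φ
    have h2 : ∀ g, φ (e g) = - φ g := by
      rintro ⟨a, b, c⟩
      have : RR A B (e (a, b, c)) = ν ^ 3 * RR A B (a, b, c) := by
        simp only [e, Equiv.coe_fn_mk, RR, Rr]; ring
      simp only [hφ]
      rw [this, map_mul, map_pow, hν]; ring
    simp_rw [h2] at h1
    rw [Finset.sum_neg_distrib] at h1
    linarith
  have hK1 : ∑ x : K, quadraticChar K (x ^ 3 + algebraMap (ZMod l) K A * x + algebraMap (ZMod l) K B)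
      = ∑ x : K, φ (S x) := by
    apply Finset.sum_congr rfl
    intro x _
    apply quadChar_norm l hl hK
    have hm : algebraMap (ZMod l) K (RR A B (S x)) = RR (algebraMap (ZMod l) K A)
        (algebraMap (ZMod l) K B) (algebraMap (ZMod l) K (S x).1, algebraMap (ZMod l) K (S x).2.1,
          algebraMap (ZMod l) K (S x).2.2) := by
      simp [RR, Rr, map_ofNat]
    rw [hm, hS, RR_sy3]
    have hf : ∀ y : K, (y ^ 3 + algebraMap (ZMod l) K A * y + algebraMap (ZMod l) K B) ^ l =
        (y ^ l) ^ 3 + algebraMap (ZMod l) K A * (y ^ l) + algebraMap (ZMod l) K B := by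
      intro y
      rw [add_pow_char, add_pow_char, mul_pow, ← map_pow, ← map_pow, ZMod.pow_card, ZMod.pow_card]
      ring
    rw [sq l, pow_mul, pow_mul, hf, hf]
  have hfib : ∀ {T : Type _} [Fintype T] (s : T → ZMod l × ZMod l × ZMod l),
      ∑ t, φ (s t) = ∑ g, ((Finset.univ.filter fun t => s t = g).card : ℤ) * φ g := by
    intro T _ s
    rw [← Finset.sum_fiberwise (s := Finset.univ) (g := s)]
    apply Finset.sum_congr rfl
    intro g _
    rw [Finset.sum_congr rfl (g := fun _ => φ g), Finset.sum_const, nsmul_eq_mul]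
    intro t ht
    rw [(Finset.mem_filter.1 ht).2]
  have hfib2 : ∑ x, φ (S x) = ∑ g, ((Finset.univ.filter fun t => S t = g).card : ℤ) * φ g := by
    rw [← Finset.sum_fiberwise (s := Finset.univ) (g := S)]
    apply Finset.sum_congr rfl
    intro g _
    rw [Finset.sum_congr rfl (g := fun _ => φ g), Finset.sum_const, nsmul_eq_mul]
    intro t ht
    rw [(Finset.mem_filter.1 ht).2]
  have hs2 : ∑ t, φ (sy2 t) = 0 := by
    simp only [hφ, RR_sy2, map_mul]
    rw [Fintype.sum_prod_type]
    simp only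
    simp_rw [← Finset.mul_sum]
    rw [← Finset.sum_mul, h, zero_mul]
  have hs3 : ∑ t, φ (sy3 t) = 0 := by
    simp only [hφ, RR_sy3, map_mul, mul_assoc]
    rw [Fintype.sum_prod_type]
    simp only
    simp_rw [← Finset.mul_sum]
    rw [← Finset.sum_mul]
    have h' : ∑ i : ZMod l, (quadraticChar (ZMod l)) (i ^ 3 + A * i + B) = 0 := h
    rw [h', zero_mul]
  rw [hfib] at hs2 hs3
  rw [hK1, hfib2]
  have hw : ∀ g, ((Finset.univ.filter fun x : K => S x = g).card : ℤ) * φ g =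
    3 * φ g + ((Finset.univ.filter fun t : ZMod l × ZMod l × ZMod l => sy3 t = g).card : ℤ) * φ g
     - 3 * (((Finset.univ.filter fun t : ZMod l × ZMod l × ZMod l => sy2 t = g).card : ℤ) * φ g) := by
    intro g
    have := weight l hl hK S hS g
    have : ((Finset.univ.filter fun x : K => S x = g).card : ℤ) +
      3 * (Finset.univ.filter fun t : ZMod l × ZMod l × ZMod l => sy2 t = g).card =
      3 + (Finset.univ.filter fun t : ZMod l × ZMod l × ZMod l => sy3 t = g).card := by
      exact_mod_cast this
    linear_combination φ g * this
  simp_rw [hw]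
  rw [Finset.sum_sub_distrib, Finset.sum_add_distrib, ← Finset.mul_sum, ← Finset.mul_sum, hc3, hs2,
    hs3]
  norm_num

/-- short Weierstrass curve -/
def SW {K : Type*} [Field K] (A B : K) : WeierstrassCurve.Affine K := ⟨0, 0, 0, A, B⟩

lemma SW_eqn {K : Type*} [Field K] (A B x y : K) :
    (SW A B).Equation x y ↔ y ^ 2 = x ^ 3 + A * x + B := by
  rw [WeierstrassCurve.Affine.equation_iff]
  simp [SW]

lemma SW_ns {K : Type*} [Field K] (h2 : (2 : K) ≠ 0) (A B : K) (hD : 4 * A ^ 3 + 27 * B ^ 2 ≠ 0)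
    (x y : K) : (SW A B).Nonsingular x y ↔ y ^ 2 = x ^ 3 + A * x + B := by
  rw [← WeierstrassCurve.Affine.equation_iff_nonsingular_of_Δ_ne_zero, SW_eqn]
  have : (SW A B).Δ = -(2 ^ 4) * (4 * A ^ 3 + 27 * B ^ 2) := by
    simp only [WeierstrassCurve.Δ, WeierstrassCurve.b₂, WeierstrassCurve.b₄, WeierstrassCurve.b₆,
      WeierstrassCurve.b₈, SW]
    ring
  rw [this]
  exact mul_ne_zero (neg_ne_zero.2 (pow_ne_zero _ h2)) hD

lemma SW_finite {K : Type*} [Field K] [Finite K] (A B : K) : Finite (SW A B).Point :=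
  have : Finite (WithZero {xy : K × K // (SW A B).Nonsingular xy.1 xy.2}) :=
    inferInstanceAs (Finite (Option {xy : K × K // (SW A B).Nonsingular xy.1 xy.2}))
  Finite.of_equiv _ (SW A B).nonsingularPointEquiv.symm

lemma SW_card {K : Type*} [Field K] [Fintype K] [DecidableEq K] (hc : ringChar K ≠ 2) (A B : K)
    (hD : 4 * A ^ 3 + 27 * B ^ 2 ≠ 0) :
    (Nat.card (SW A B).Point : ℤ) =
      Fintype.card K + 1 + ∑ x : K, quadraticChar K (x ^ 3 + A * x + B) := by
  have h2 : (2 : K) ≠ 0 := Ring.two_ne_zero hc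
  rw [Nat.card_congr (SW A B).nonsingularPointEquiv]
  have e : Nat.card (WithZero {xy : K × K // (SW A B).Nonsingular xy.1 xy.2}) =
      Nat.card {xy : K × K // (SW A B).Nonsingular xy.1 xy.2} + 1 := by
    exact Finite.card_option
  rw [e]
  have e2 : Nat.card {xy : K × K // (SW A B).Nonsingular xy.1 xy.2} =
      ∑ x : K, {y : K | y ^ 2 = x ^ 3 + A * x + B}.toFinset.card := by
    have : {xy : K × K // (SW A B).Nonsingular xy.1 xy.2} ≃
        Σ x : K, {y : K // y ^ 2 = x ^ 3 + A * x + B} :=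
      { toFun := fun p => ⟨p.1.1, p.1.2, (SW_ns h2 A B hD _ _).1 p.2⟩
        invFun := fun p => ⟨(p.1, p.2.1), (SW_ns h2 A B hD _ _).2 p.2.2⟩
        left_inv := fun p => rfl
        right_inv := fun p => rfl }
    rw [Nat.card_congr this, Nat.card_sigma]
    apply Finset.sum_congr rfl
    intro x _
    rw [Nat.card_eq_fintype_card, Set.toFinset_card]
    rfl
  rw [e2]
  push_cast
  simp_rw [quadraticChar_card_sqrts hc]
  rw [Finset.sum_add_distrib]
  simp
  ring

lemma SW_dbl {K : Type*} [Field K] [DecidableEq K] (h2 : (2 : K) ≠ 0) (A B : K)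
    {x y s x' y' : K}
    (h : (SW A B).Nonsingular x y) (h' : (SW A B).Nonsingular x' y') (hy : y ≠ 0)
    (hs : 2 * y * s = 3 * x ^ 2 + A)
    (hx' : x' = s ^ 2 - 2 * x) (hy' : y' = -(s * (x' - x) + y)) :
    (WeierstrassCurve.Affine.Point.some x y h) + (.some x y h) = .some x' y' h' := by
  have hne : y ≠ (SW A B).negY x y := by
    simp only [WeierstrassCurve.Affine.negY, SW]
    intro e
    have : 2 * y = 0 := by linear_combination e
    rcases mul_eq_zero.1 this with h | h
    · exact h2 h
    · exact hy h
  rw [WeierstrassCurve.Affine.Point.add_self_of_Y_ne hne]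
  have hsl : (SW A B).slope x x y y = s := by
    rw [WeierstrassCurve.Affine.slope_of_Y_ne rfl hne]
    simp only [WeierstrassCurve.Affine.negY, SW]
    have : y - (-y - 0 * x - 0) ≠ 0 := by
      have := mul_ne_zero h2 hy
      intro h; apply this; linear_combination h
    rw [div_eq_iff this]
    linear_combination -hs
  simp only [WeierstrassCurve.Affine.Point.some.injEq, hsl]
  simp only [WeierstrassCurve.Affine.addX, WeierstrassCurve.Affine.addY,
    WeierstrassCurve.Affine.negAddY, WeierstrassCurve.Affine.negY, SW]
  constructor
  · rw [hx']; ring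
  · rw [hy', hx']; ring

/-- converse: extracting data of doubling -/
lemma SW_dbl' {K : Type*} [Field K] [DecidableEq K] (h2 : (2 : K) ≠ 0) (A B : K)
    {x y x' y' : K}
    (h : (SW A B).Nonsingular x y) (h' : (SW A B).Nonsingular x' y') (hy : y ≠ 0)
    (he : (WeierstrassCurve.Affine.Point.some x y h) + (.some x y h) = .some x' y' h') :
    ∃ s, 2 * y * s = 3 * x ^ 2 + A ∧ x' = s ^ 2 - 2 * x ∧ y' = -(s * (x' - x) + y) := by
  have hne : y ≠ (SW A B).negY x y := by
    simp only [WeierstrassCurve.Affine.negY, SW]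
    intro e
    have : 2 * y = 0 := by linear_combination e
    rcases mul_eq_zero.1 this with h | h
    · exact h2 h
    · exact hy h
  rw [WeierstrassCurve.Affine.Point.add_self_of_Y_ne hne] at he
  simp only [WeierstrassCurve.Affine.Point.some.injEq] at he
  obtain ⟨e1, e2⟩ := he
  refine ⟨(SW A B).slope x x y y, ?_, ?_, ?_⟩
  · rw [WeierstrassCurve.Affine.slope_of_Y_ne rfl hne]
    simp only [WeierstrassCurve.Affine.negY, SW]
    have : y - (-y - 0 * x - 0) ≠ 0 := by
      have := mul_ne_zero h2 hy
      intro h; apply this; linear_combination h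
    rw [← mul_div_assoc, div_eq_iff this]
    ring
  · rw [← e1]
    simp only [WeierstrassCurve.Affine.addX, SW]; ring
  · rw [← e2, ← e1]
    simp only [WeierstrassCurve.Affine.addY, WeierstrassCurve.Affine.addX,
      WeierstrassCurve.Affine.negAddY, WeierstrassCurve.Affine.negY, SW]; ring

lemma SW_add' {K : Type*} [Field K] [DecidableEq K] (A B : K)
    {x y x2 y2 x3 y3 : K}
    (h : (SW A B).Nonsingular x y) (h2 : (SW A B).Nonsingular x2 y2)
    (h3 : (SW A B).Nonsingular x3 y3) (hx : x ≠ x2)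
    (he : (WeierstrassCurve.Affine.Point.some x y h) + (.some x2 y2 h2) = - .some x3 y3 h3) :
    ∃ s, y2 - y = s * (x2 - x) ∧ x3 = s ^ 2 - x - x2 ∧ y3 = s * (x3 - x) + y := by
  rw [WeierstrassCurve.Affine.Point.add_of_X_ne hx, WeierstrassCurve.Affine.Point.neg_some] at he
  simp only [WeierstrassCurve.Affine.Point.some.injEq] at he
  obtain ⟨e1, e2⟩ := he
  have hxs : x - x2 ≠ 0 := sub_ne_zero.2 hx
  refine ⟨(SW A B).slope x x2 y y2, ?_, ?_, ?_⟩
  · rw [WeierstrassCurve.Affine.slope_of_X_ne hx]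
    rw [div_mul_eq_mul_div, eq_div_iff hxs]
    ring
  · rw [← e1]
    simp only [WeierstrassCurve.Affine.addX, SW]; ring
  · rw [← e1]
    simp only [WeierstrassCurve.Affine.addY, WeierstrassCurve.Affine.addX,
      WeierstrassCurve.Affine.negAddY, WeierstrassCurve.Affine.negY, SW] at e2 ⊢
    linear_combination e2

def tb2 {K : Type*} [CommRing K] (d : K) : K := (1 - (d ^ 2 - d)) ^ 2 - 4 * (d ^ 3 - d ^ 2)
def tc4 {K : Type*} [CommRing K] (d : K) : K :=
  (d^2 - d + 1) * (d^6 - 11*d^5 + 30*d^4 - 15*d^3 - 10*d^2 + 5*d + 1)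
def tc6 {K : Type*} [CommRing K] (d : K) : K :=
  -(tb2 d)^3 + 36 * tb2 d * (-(d ^ 3 - d ^ 2) * (1 - (d ^ 2 - d))) - 216 * (d ^ 3 - d ^ 2) ^ 2
def tD {K : Type*} [CommRing K] (d : K) : K := d^7 * (d-1)^7 * (d^3 - 8*d^2 + 5*d + 1)

lemma tc_rel {K : Type*} [CommRing K] (d : K) : tc4 d ^ 3 - tc6 d ^ 2 = 1728 * tD d := by
  simp only [tc4, tc6, tD, tb2]; ring

lemma tD_disc {K : Type*} [CommRing K] (d v : K) :
    4 * (-27 * tc4 d * v ^ 4) ^ 3 + 27 * (-54 * tc6 d * v ^ 6) ^ 2 =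
      - (2 ^ 8 * 3 ^ 12) * tD d * v ^ 12 := by
  linear_combination (-78732 * v ^ 12) * tc_rel d

/-- the point on the curve attached to the parameter (d, v) -/
lemma tor_eqn {K : Type*} [Field K] (d v : K) :
    (-108 * (d^3 - d^2) * v ^ 3) ^ 2 = (3 * tb2 d * v^2) ^ 3 +
      (-27 * tc4 d * v ^ 4) * (3 * tb2 d * v^2) + (-54 * tc6 d * v ^ 6) := by
  simp only [tc4, tc6, tb2]; ring

lemma tor_eqn2 {K : Type*} [Field K] (d v : K) :
    (108 * (d^3 - d^2) * (d^2 - d) * v ^ 3) ^ 2 = ((36 * (d^3-d^2) + 3 * tb2 d) * v^2) ^ 3 +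
      (-27 * tc4 d * v ^ 4) * ((36 * (d^3-d^2) + 3 * tb2 d) * v^2) + (-54 * tc6 d * v ^ 6) := by
  simp only [tc4, tc6, tb2]; ring

lemma tor_eqn3 {K : Type*} [Field K] (d v : K) :
    (108 * d * (d-1)^3 * v ^ 3) ^ 2 = ((36 * (d^2-d) + 3 * tb2 d) * v^2) ^ 3 +
      (-27 * tc4 d * v ^ 4) * ((36 * (d^2-d) + 3 * tb2 d) * v^2) + (-54 * tc6 d * v ^ 6) := by
  simp only [tc4, tc6, tb2]; ring

section
variable {K : Type*} [Field K] [DecidableEq K]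

lemma tor7 (h2 : (2 : K) ≠ 0) (h3 : (3 : K) ≠ 0) (A B d v : K) (hv : v ≠ 0)
    (hA : A = -27 * tc4 d * v ^ 4) (hB : B = -54 * tc6 d * v ^ 6)
    (hD : 4 * A ^ 3 + 27 * B ^ 2 ≠ 0)
    (h : (SW A B).Nonsingular (3 * tb2 d * v^2) (-108 * (d^3 - d^2) * v ^ 3)) :
    (7 : ℕ) • (WeierstrassCurve.Affine.Point.some _ _ h) = 0 := by
  have hD' := hD
  rw [hA, hB, tD_disc] at hD'
  have hd : d ≠ 0 := by rintro rfl; simp [tD] at hD'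
  have hd1 : d - 1 ≠ 0 := by intro e; simp [tD, e] at hD'
  have h108 : (108 : K) ≠ 0 := by
    rw [show (108 : K) = 2 ^ 2 * 3 ^ 3 by norm_num]
    exact mul_ne_zero (pow_ne_zero _ h2) (pow_ne_zero _ h3)
  have n2 : (SW A B).Nonsingular ((36 * (d^3-d^2) + 3 * tb2 d) * v^2)
      (108 * (d^3 - d^2) * (d^2 - d) * v ^ 3) := by
    rw [SW_ns h2 A B hD, hA, hB]; exact tor_eqn2 d v
  have n3 : (SW A B).Nonsingular ((36 * (d^2-d) + 3 * tb2 d) * v^2)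
      (108 * d * (d-1)^3 * v ^ 3) := by
    rw [SW_ns h2 A B hD, hA, hB]; exact tor_eqn3 d v
  have y1 : -108 * (d^3 - d^2) * v ^ 3 ≠ 0 := by
    rw [show d^3 - d^2 = d^2 * (d-1) by ring]
    exact mul_ne_zero (mul_ne_zero (neg_ne_zero.2 h108) (mul_ne_zero (pow_ne_zero _ hd) hd1))
      (pow_ne_zero _ hv)
  have y2 : 108 * (d^3 - d^2) * (d^2 - d) * v ^ 3 ≠ 0 := by
    rw [show 108 * (d^3 - d^2) * (d^2 - d) = 108 * (d^3 * (d-1)^2) by ring]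
    exact mul_ne_zero (mul_ne_zero h108 (mul_ne_zero (pow_ne_zero _ hd) (pow_ne_zero _ hd1)))
      (pow_ne_zero _ hv)
  have y3 : 108 * d * (d-1)^3 * v ^ 3 ≠ 0 :=
    mul_ne_zero (mul_ne_zero (mul_ne_zero h108 hd) (pow_ne_zero _ hd1)) (pow_ne_zero _ hv)
  have d1 := SW_dbl h2 A B (s := 3 * (1 - (d^2-d)) * v) h n2 y1
    (by rw [hA]; simp only [tc4, tb2]; ring) (by simp only [tb2]; ring) (by simp only [tb2]; ring)
  have d2 := SW_dbl h2 A B (s := 3 * (d^2 + d - 1) * v) n2 n3 y2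
    (by rw [hA]; simp only [tc4, tb2]; ring) (by simp only [tb2]; ring) (by simp only [tb2]; ring)
  have d3 := SW_dbl h2 A B (s := 3 * (1 + d^2 - 3 * d) * v) n3 h y3
    (by rw [hA]; simp only [tc4, tb2]; ring) (by simp only [tb2]; ring) (by simp only [tb2]; ring)
  set P := WeierstrassCurve.Affine.Point.some _ _ h with hP
  have h8 : (8 : ℕ) • P = P := by
    rw [show (8 : ℕ) • P = ((P + P) + (P + P)) + ((P + P) + (P + P)) by abel]
    rw [d1, d2, d3]
  have : (7 : ℕ) • P + P = P := by rw [← succ_nsmul]; exact h8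
  simpa using this

lemma tor_inj (h2 : (2 : K) ≠ 0) (h3 : (3 : K) ≠ 0) (A B d v d' v' : K) (hv : v ≠ 0) (hv' : v' ≠ 0)
    (hA : A = -27 * tc4 d * v ^ 4) (hB : B = -54 * tc6 d * v ^ 6)
    (hA' : A = -27 * tc4 d' * v' ^ 4) (hB' : B = -54 * tc6 d' * v' ^ 6)
    (hD : 4 * A ^ 3 + 27 * B ^ 2 ≠ 0)
    (hx : 3 * tb2 d * v^2 = 3 * tb2 d' * v'^2)
    (hy : -108 * (d^3 - d^2) * v ^ 3 = -108 * (d'^3 - d'^2) * v' ^ 3) : d = d' ∧ v = v' := by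
  have hD' := hD
  rw [hA, hB, tD_disc] at hD'
  have hd : d ≠ 0 := by rintro rfl; simp [tD] at hD'
  have hd1 : d - 1 ≠ 0 := by intro e; simp [tD, e] at hD'
  have h108 : (108 : K) ≠ 0 := by
    rw [show (108 : K) = 2 ^ 2 * 3 ^ 3 by norm_num]
    exact mul_ne_zero (pow_ne_zero _ h2) (pow_ne_zero _ h3)
  have h36 : (36 : K) ≠ 0 := by
    rw [show (36 : K) = 2 ^ 2 * 3 ^ 2 by norm_num]
    exact mul_ne_zero (pow_ne_zero _ h2) (pow_ne_zero _ h3)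
  have y1 : -108 * (d^3 - d^2) * v ^ 3 ≠ 0 := by
    rw [show d^3 - d^2 = d^2 * (d-1) by ring]
    exact mul_ne_zero (mul_ne_zero (neg_ne_zero.2 h108) (mul_ne_zero (pow_ne_zero _ hd) hd1))
      (pow_ne_zero _ hv)
  -- slopes agree
  have s1 : 3 * (1 - (d^2-d)) * v = 3 * (1 - (d'^2-d')) * v' := by
    have e1 : 2 * (-108 * (d^3 - d^2) * v ^ 3) * (3 * (1 - (d^2-d)) * v) =
        3 * (3 * tb2 d * v^2)^2 + A := by rw [hA]; simp only [tc4, tb2]; ring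
    have e2 : 2 * (-108 * (d'^3 - d'^2) * v' ^ 3) * (3 * (1 - (d'^2-d')) * v') =
        3 * (3 * tb2 d' * v'^2)^2 + A := by rw [hA']; simp only [tc4, tb2]; ring
    rw [← hx, ← hy] at e2
    exact mul_left_cancel₀ (mul_ne_zero h2 y1) (e1.trans e2.symm)
  have x2 : (36 * (d^3-d^2) + 3 * tb2 d) * v^2 = (36 * (d'^3-d'^2) + 3 * tb2 d') * v'^2 := by
    have e1 : (36 * (d^3-d^2) + 3 * tb2 d) * v^2 = (3 * (1 - (d^2-d)) * v)^2 - 2 * (3 * tb2 d * v^2) := by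
      simp only [tb2]; ring
    have e2 : (36 * (d'^3-d'^2) + 3 * tb2 d') * v'^2 =
      (3 * (1 - (d'^2-d')) * v')^2 - 2 * (3 * tb2 d' * v'^2) := by simp only [tb2]; ring
    rw [e1, e2, s1, hx]
  have p : (d^3-d^2) * v^2 = (d'^3-d'^2) * v'^2 := by
    apply mul_left_cancel₀ h36; linear_combination x2 - hx
  have hb : (d^3 - d^2) * v^2 ≠ 0 := by
    rw [show d^3 - d^2 = d^2 * (d-1) by ring]
    exact mul_ne_zero (mul_ne_zero (pow_ne_zero _ hd) hd1) (pow_ne_zero _ hv)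
  have hvv : v = v' := by
    apply mul_left_cancel₀ (mul_ne_zero h108 hb)
    linear_combination -hy - 108 * v' * p
  subst hvv
  refine ⟨?_, rfl⟩
  have hc : d^2 - d = d'^2 - d' := by
    have := mul_right_cancel₀ hv s1
    apply mul_left_cancel₀ h3; linear_combination -this
  have hb' := mul_right_cancel₀ (pow_ne_zero _ hv) p
  have hc0 : d^2 - d ≠ 0 := by
    rw [show d^2 - d = d * (d-1) by ring]; exact mul_ne_zero hd hd1
  apply mul_right_cancel₀ hc0
  have : d' * (d ^ 2 - d) = d' * (d' ^ 2 - d') := by rw [hc]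
  linear_combination hb' - this

end

/-- the algebra behind surjectivity -/
lemma tor_alg {K : Type*} [Field K] (h2 : (2 : K) ≠ 0) (h3 : (3 : K) ≠ 0)
    (A B x1 y1 x2 y2 x3 y3 s1 s2 s3 t : K) (hy1 : y1 ≠ 0)
    (h12 : x1 ≠ x2) (h13 : x1 ≠ x3) (h23 : x2 ≠ x3)
    (e1 : y1 ^ 2 = x1 ^ 3 + A * x1 + B) (e2 : y2 ^ 2 = x2 ^ 3 + A * x2 + B)
    (a1 : 2 * y1 * s1 = 3 * x1 ^ 2 + A) (c1 : y2 = -(s1 * (x2 - x1) + y1))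
    (a2 : 2 * y2 * s2 = 3 * x2 ^ 2 + A) (c2 : y3 = -(s2 * (x3 - x2) + y2))
    (a3 : 2 * y3 * s3 = 3 * x3 ^ 2 + A) (c3 : y1 = -(s3 * (x1 - x3) + y3))
    (t1 : y2 - y1 = t * (x2 - x1)) (t2 : x3 = t ^ 2 - x1 - x2) (t3 : y3 = t * (x3 - x1) + y1) :
    ∃ d v : K, v ≠ 0 ∧ A = -27 * tc4 d * v ^ 4 ∧ B = -54 * tc6 d * v ^ 6 ∧
      x1 = 3 * tb2 d * v^2 ∧ y1 = -108 * (d^3 - d^2) * v ^ 3 := by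
  obtain ⟨p, hp⟩ : ∃ p, p = x2 - x1 := ⟨_, rfl⟩
  obtain ⟨r, hr⟩ : ∃ r, r = x3 - x1 := ⟨_, rfl⟩
  have hp0 : p ≠ 0 := by rw [hp]; exact sub_ne_zero.2 h12.symm
  have hr0 : r ≠ 0 := by rw [hr]; exact sub_ne_zero.2 h13.symm
  have hpr : p - r ≠ 0 := by rw [hp, hr]; intro h; apply h23; linear_combination h
  have ex2 : x2 = x1 + p := by rw [hp]; ring
  have ex3 : x3 = x1 + r := by rw [hr]; ring
  have h3x : 3 * x1 + p + r = t ^ 2 := by rw [hp, hr]; linear_combination t2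
  have ey2 : y2 = y1 + t * p := by rw [hp]; linear_combination t1
  have ey3 : y3 = y1 + t * r := by rw [hr]; linear_combination t3
  -- derivative relation
  have hA : 3 * x1 ^ 2 + A = 2 * y1 * t + p * r := by
    apply mul_left_cancel₀ hp0
    rw [ey2, ex2] at e2
    linear_combination e1 - e2 - p ^ 2 * h3x
  have k1 : 4 * y1 * y2 = -(p ^ 2 * r) := by
    have : p * s1 = -(y1 + y2) := by rw [hp]; linear_combination c1
    have h := hA
    rw [← a1] at h
    linear_combination (-p) * h + 2 * y1 * this + (2 * y1) * ey2
  have hA2 : 3 * x2 ^ 2 + A = 2 * y2 * t + p * (p - r) := by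
    rw [ex2, ey2]; linear_combination hA + 2 * p * h3x
  have k2 : 4 * y2 * y3 = p * (p - r) ^ 2 := by
    have : (r - p) * s2 = -(y2 + y3) := by rw [hp, hr]; linear_combination c2
    have h := hA2
    rw [← a2] at h
    linear_combination (p - r) * h + 2 * y2 * this + (2 * y2) * (ey3 - ey2)
  have hA3 : 3 * x3 ^ 2 + A = 2 * y3 * t + r * (r - p) := by
    rw [ex3, ey3]; linear_combination hA + 2 * r * h3x
  have k3 : 4 * y3 * y1 = r ^ 2 * (r - p) := by
    have : r * s3 = (y1 + y3) := by rw [hr]; linear_combination -c3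
    have h := hA3
    rw [← a3] at h
    linear_combination (r) * h - 2 * y3 * this - (2 * y3) * ey3
  have hy2 : y2 ≠ 0 := by
    rintro rfl
    have : p ^ 2 * r = 0 := by linear_combination k1
    exact mul_ne_zero (pow_ne_zero 2 hp0) hr0 this
  have k4 : 4 * y1 ^ 2 * (p - r) = p * r ^ 3 := by
    have hz : p * (p - r) ≠ 0 := mul_ne_zero hp0 hpr
    apply mul_left_cancel₀ hz
    linear_combination (-4 * y1 ^ 2) * k2 + 4 * y1 * y3 * k1 - p ^ 2 * r * k3
  -- parameters
  obtain ⟨d, hd⟩ : ∃ d, d = p / r := ⟨_, rfl⟩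
  obtain ⟨v, hv⟩ : ∃ v, v = -y1 / (3 * p) := ⟨_, rfl⟩
  have hpd : p = d * r := by rw [hd]; field_simp
  have hyv : y1 = -3 * p * v := by rw [hv]; field_simp
  have hv0 : v ≠ 0 := by
    rintro h; rw [h] at hyv; apply hy1; rw [hyv]; ring
  have hd0 : d ≠ 0 := by rintro h; rw [h] at hpd; apply hp0; rw [hpd]; ring
  have hrv : r = 36 * d * (d - 1) * v ^ 2 := by
    have h := k4
    rw [hyv, hpd] at h
    have hz : d * r ^ 3 ≠ 0 := mul_ne_zero hd0 (pow_ne_zero _ hr0)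
    apply mul_left_cancel₀ hz
    linear_combination -h
  have hpv : p = 36 * d ^ 2 * (d - 1) * v ^ 2 := by rw [hpd, hrv]; ring
  have hy1v : y1 = -108 * (d^3 - d^2) * v ^ 3 := by rw [hyv, hpv]; ring
  have hd1 : d - 1 ≠ 0 := by rintro h; apply hr0; rw [hrv, h]; ring
  have hy2v : y2 = 108 * (d^3 - d^2) * (d^2 - d) * v ^ 3 := by
    have hz : 4 * y1 ≠ 0 := by
      rw [show (4 : K) = 2 * 2 by norm_num]; exact mul_ne_zero (mul_ne_zero h2 h2) hy1
    apply mul_left_cancel₀ hz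
    rw [k1, hy1v, hpv, hrv]; ring
  have htv : t = 3 * v * (d^2 - d + 1) := by
    apply mul_right_cancel₀ hp0
    have : t * p = y2 - y1 := by rw [ey2]; ring
    rw [this, hy2v, hy1v, hpv]; ring
  have hxv : x1 = 3 * tb2 d * v ^ 2 := by
    apply mul_left_cancel₀ h3
    have : 3 * x1 = t ^ 2 - p - r := by linear_combination h3x
    rw [this, htv, hpv, hrv]
    simp only [tb2]; ring
  have hAv : A = -27 * tc4 d * v ^ 4 := by
    have : A = 2 * y1 * t + p * r - 3 * x1 ^ 2 := by linear_combination hA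
    rw [this, hy1v, htv, hpv, hrv, hxv]
    simp only [tb2, tc4]; ring
  refine ⟨d, v, hv0, hAv, ?_, hxv, hy1v⟩
  have : B = y1 ^ 2 - x1 ^ 3 - A * x1 := by linear_combination -e1
  rw [this, hAv, hxv, hy1v, tor_eqn]; ring

lemma SW_y_ne {K : Type*} [Field K] [DecidableEq K] (A B : K)
    {x y : K} (h : (SW A B).Nonsingular x y)
    (hn : (WeierstrassCurve.Affine.Point.some x y h) + (.some x y h) ≠ 0) : y ≠ 0 := by
  rintro rfl
  apply hn
  apply WeierstrassCurve.Affine.Point.add_self_of_Y_eq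
  simp [WeierstrassCurve.Affine.negY, SW]

lemma SW_x_ne {K : Type*} [Field K] [DecidableEq K] (A B : K)
    {x y x' y' : K} (h : (SW A B).Nonsingular x y) (h' : (SW A B).Nonsingular x' y')
    (h1 : WeierstrassCurve.Affine.Point.some x y h ≠ .some x' y' h')
    (h2 : WeierstrassCurve.Affine.Point.some x y h ≠ - .some x' y' h') : x ≠ x' := by
  intro e
  rcases (WeierstrassCurve.Affine.Point.X_eq_iff (h₁ := h) (h₂ := h')).1 e with h | h
  · exact h1 h
  · exact h2 h

lemma tor_surj {K : Type*} [Field K] [DecidableEq K] (h2 : (2 : K) ≠ 0) (h3 : (3 : K) ≠ 0)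
    (A B : K) (hD : 4 * A ^ 3 + 27 * B ^ 2 ≠ 0) (P : (SW A B).Point) (hP0 : P ≠ 0)
    (hP : (7 : ℕ) • P = 0) :
    ∃ d v : K, v ≠ 0 ∧ A = -27 * tc4 d * v ^ 4 ∧ B = -54 * tc6 d * v ^ 6 ∧
      ∃ h, P = .some (3 * tb2 d * v^2) (-108 * (d^3 - d^2) * v ^ 3) h := by
  have key : ∀ n : ℕ, ¬ 7 ∣ n → n • P ≠ 0 := by
    intro n hn h
    apply hP0
    have hc : Nat.Coprime 7 n := (Nat.Prime.coprime_iff_not_dvd (by norm_num)).2 hn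
    have h1 := addOrderOf_dvd_of_nsmul_eq_zero hP
    have h2 := addOrderOf_dvd_of_nsmul_eq_zero h
    have := Nat.dvd_gcd h1 h2
    rw [hc.gcd_eq_one, Nat.dvd_one, AddMonoid.addOrderOf_eq_one_iff] at this
    exact this
  have e2 : P + P = 2 • P := by abel
  have e4 : 2 • P + 2 • P = 4 • P := by abel
  have e8 : 4 • P + 4 • P = P := by
    rw [show 4 • P + 4 • P = 7 • P + P by abel, hP, zero_add]
  have esum : P + 2 • P = - (4 • P) := by
    rw [eq_neg_iff_add_eq_zero, ← hP]; abel
  have n1 : P + P ≠ 0 := by rw [e2]; exact key 2 (by norm_num)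
  have n2 : 2 • P + 2 • P ≠ 0 := by rw [e4]; exact key 4 (by norm_num)
  have n3 : 4 • P + 4 • P ≠ 0 := by rw [e8]; exact hP0
  have k : ∀ m n : ℕ, m < n → ¬ 7 ∣ (n - m) → m • P ≠ n • P := by
    intro m n hmn h7 h
    apply key (n - m) h7
    have : (n - m) • P + m • P = m • P := by
      rw [← add_nsmul, Nat.sub_add_cancel hmn.le, h]
    simpa using this
  have k' : ∀ m n : ℕ, ¬ 7 ∣ (m + n) → m • P ≠ - (n • P) := by
    intro m n h7 h
    apply key (m + n) h7
    rw [add_nsmul, h, neg_add_cancel]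
  have d12 : P ≠ 2 • P := by simpa using k 1 2 (by norm_num) (by norm_num)
  have d13 : P ≠ 4 • P := by simpa using k 1 4 (by norm_num) (by norm_num)
  have d23 := k 2 4 (by norm_num) (by norm_num)
  have d12' : P ≠ - (2 • P) := by simpa using k' 1 2 (by norm_num)
  have d13' : P ≠ - (4 • P) := by simpa using k' 1 4 (by norm_num)
  have d23' := k' 2 4 (by norm_num)
  have p20 : 2 • P ≠ 0 := key 2 (by norm_num)
  have p40 : 4 • P ≠ 0 := key 4 (by norm_num)
  clear k k' key hP
  generalize 2 • P = Q at *
  generalize 4 • P = R at *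
  obtain _ | ⟨x1, y1, g1⟩ := P
  · exact absurd rfl hP0
  obtain _ | ⟨x2, y2, g2⟩ := Q
  · exact absurd rfl p20
  obtain _ | ⟨x3, y3, g3⟩ := R
  · exact absurd rfl p40
  have hy1 := SW_y_ne A B g1 n1
  have hy2 := SW_y_ne A B g2 n2
  have hy3 := SW_y_ne A B g3 n3
  obtain ⟨s1, a1, b1, c1⟩ := SW_dbl' h2 A B g1 g2 hy1 e2
  obtain ⟨s2, a2, b2, c2⟩ := SW_dbl' h2 A B g2 g3 hy2 e4
  obtain ⟨s3, a3, b3, c3⟩ := SW_dbl' h2 A B g3 g1 hy3 e8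
  have hx12 := SW_x_ne A B g1 g2 d12 d12'
  have hx13 := SW_x_ne A B g1 g3 d13 d13'
  have hx23 := SW_x_ne A B g2 g3 d23 d23'
  obtain ⟨t, t1, t2, t3⟩ := SW_add' A B g1 g2 g3 hx12 esum
  obtain ⟨d, v, hv, hA, hB, hx, hy⟩ := tor_alg h2 h3 A B x1 y1 x2 y2 x3 y3 s1 s2 s3 t hy1 hx12 hx13
    hx23 ((SW_ns h2 A B hD _ _).1 g1) ((SW_ns h2 A B hD _ _).1 g2) a1 c1 a2 c2 a3 c3 t1 t2 t3
  refine ⟨d, v, hv, hA, hB, hx ▸ hy ▸ g1, ?_⟩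
  simp only [WeierstrassCurve.Affine.Point.some.injEq]
  exact ⟨hx, hy⟩

lemma tcop {K : Type*} [Field K] (h7 : (7 : K) ≠ 0) (d : K) (h4 : tc4 d = 0) : tD d ≠ 0 := by
  intro h
  have h' : d = 0 ∨ d = 1 ∨ d^3 - 8*d^2 + 5*d + 1 = 0 := by
    simp only [tD] at h
    rcases mul_eq_zero.1 h with h | h
    · rcases mul_eq_zero.1 h with h | h
      · exact Or.inl (pow_eq_zero_iff (by norm_num) |>.1 h)
      · exact Or.inr (Or.inl (sub_eq_zero.1 (pow_eq_zero_iff (by norm_num) |>.1 h)))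
    · exact Or.inr (Or.inr h)
  rcases h' with rfl | rfl | h'
  · simp [tc4] at h4
  · simp [tc4] at h4; norm_num at h4
  · apply pow_ne_zero 2 h7
    simp only [tc4] at h4
    linear_combination ((1710) + (3005)*d + (-444)*d^2) * h4 + ((-1661) + (-1540)*d^1 + (6776)*d^2 + (-693)*d^3 + (-6853)*d^4 + (12530)*d^5 + (-4781)*d^6 + (444)*d^7) * h'

section
variable {K : Type*} [Field K] [Fintype K] [DecidableEq K]

lemma fib_card (hc : ringChar K ≠ 2) (h2 : (2 : K) ≠ 0) (h3 : (3 : K) ≠ 0) (h7 : (7 : K) ≠ 0)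
    (j A B d : K) (hA : A ≠ 0) (hB : B ≠ 0) (hj0 : j ≠ 0) (hj1 : j ≠ 1728)
    (hj : 1728 * (4 * A ^ 3) = j * (4 * A ^ 3 + 27 * B ^ 2))
    (hd : tc4 d ^ 3 = j * tD d) :
    ((Finset.univ.filter (fun v : K => v ≠ 0 ∧ A = -27 * tc4 d * v ^ 4 ∧
      B = -54 * tc6 d * v ^ 6)).card : ℤ) =
      quadraticChar K (B * (-27 * tc4 d) / ((-54 * tc6 d) * A)) + 1 := by
  have n4 : tc4 d ≠ 0 := by
    intro h
    rw [h] at hd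
    have : j * tD d = 0 := by rw [← hd]; ring
    exact mul_ne_zero hj0 (tcop h7 d h) this
  have n6 : tc6 d ≠ 0 := by
    intro h
    have r := tc_rel d
    rw [h, hd] at r
    have : (j - 1728) * tD d = 0 := by linear_combination r
    rcases mul_eq_zero.1 this with h' | h'
    · exact hj1 (sub_eq_zero.1 h')
    · rw [h', mul_zero] at hd
      exact n4 (pow_eq_zero_iff (by norm_num) |>.1 hd)
  have h27 : (27 : K) ≠ 0 := by
    rw [show (27 : K) = 3 ^ 3 by norm_num]; exact pow_ne_zero _ h3
  have h54 : (54 : K) ≠ 0 := by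
    rw [show (54 : K) = 2 * 3 ^ 3 by norm_num]; exact mul_ne_zero h2 (pow_ne_zero _ h3)
  obtain ⟨a, ha⟩ : ∃ a, a = -27 * tc4 d := ⟨_, rfl⟩
  obtain ⟨b, hb⟩ : ∃ b, b = -54 * tc6 d := ⟨_, rfl⟩
  have a0 : a ≠ 0 := by rw [ha]; exact mul_ne_zero (neg_ne_zero.2 h27) n4
  have b0 : b ≠ 0 := by rw [hb]; exact mul_ne_zero (neg_ne_zero.2 h54) n6
  have hj' : 1728 * (4 * a ^ 3) = j * (4 * a ^ 3 + 27 * b ^ 2) := by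
    have := tD_disc d 1
    simp only [one_pow, mul_one] at this
    rw [ha, hb, this]
    linear_combination (-(2 ^ 8 * 3 ^ 12)) * hd
  have cross : A ^ 3 * b ^ 2 = a ^ 3 * B ^ 2 := by
    have hz : 4 * (1728 - j) * (27 * j) ≠ 0 := by
      refine mul_ne_zero (mul_ne_zero ?_ (sub_ne_zero.2 hj1.symm)) (mul_ne_zero h27 hj0)
      rw [show (4 : K) = 2 * 2 by norm_num]; exact mul_ne_zero h2 h2
    apply mul_left_cancel₀ hz
    linear_combination (27 * j * b ^ 2) * hj - 27 * j * B ^ 2 * hj'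
  rw [← ha, ← hb]
  rw [← quadraticChar_card_sqrts hc]
  congr 2
  ext v
  simp only [Finset.mem_filter, Finset.mem_univ, true_and, Set.mem_toFinset, Set.mem_setOf_eq]
  constructor
  · rintro ⟨hv, rfl, rfl⟩
    field_simp
  · intro h
    have hv : v ≠ 0 := by
      rintro rfl
      rw [eq_comm, zero_pow (by norm_num), div_eq_zero_iff] at h
      rcases h with h | h
      · exact mul_ne_zero hB a0 h
      · exact mul_ne_zero b0 hA h
    refine ⟨hv, ?_, ?_⟩
    · rw [show v ^ 4 = (v ^ 2) ^ 2 by ring, h]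
      field_simp
      linear_combination cross
    · rw [show v ^ 6 = (v ^ 2) ^ 3 by ring, h]
      field_simp
      linear_combination cross

/-- parameters for the 7-torsion points -/
def Spar (A B : K) : Finset (K × K) := Finset.univ.filter (fun p : K × K => p.2 ≠ 0 ∧
  A = -27 * tc4 p.1 * p.2 ^ 4 ∧ B = -54 * tc6 p.1 * p.2 ^ 6)

def RH (j : K) : Finset K := Finset.univ.filter (fun d : K => tc4 d ^ 3 = j * tD d)

lemma Spar_card (hc : ringChar K ≠ 2) (h2 : (2 : K) ≠ 0) (h3 : (3 : K) ≠ 0) (h7 : (7 : K) ≠ 0)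
    (j A B : K) (hA : A ≠ 0) (hB : B ≠ 0) (hj0 : j ≠ 0) (hj1 : j ≠ 1728)
    (hj : 1728 * (4 * A ^ 3) = j * (4 * A ^ 3 + 27 * B ^ 2)) :
    ((Spar A B).card : ℤ) = ∑ d ∈ RH j,
      (quadraticChar K (B * (-27 * tc4 d) / ((-54 * tc6 d) * A)) + 1) := by
  have hm : ∀ p ∈ Spar A B, p.1 ∈ RH j := by
    rintro ⟨d, v⟩ hp
    simp only [Spar, Finset.mem_filter, Finset.mem_univ, true_and] at hp
    obtain ⟨hv, ha, hb⟩ := hp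
    simp only [RH, Finset.mem_filter, Finset.mem_univ, true_and]
    rw [ha, hb, tD_disc] at hj
    have hz : (2 : K) ^ 8 * 3 ^ 12 * v ^ 12 ≠ 0 :=
      mul_ne_zero (mul_ne_zero (pow_ne_zero _ h2) (pow_ne_zero _ h3)) (pow_ne_zero _ hv)
    apply mul_left_cancel₀ hz
    linear_combination -hj
  rw [Finset.card_eq_sum_card_fiberwise hm]
  push_cast
  apply Finset.sum_congr rfl
  intro d hd
  simp only [RH, Finset.mem_filter, Finset.mem_univ, true_and] at hd
  rw [← fib_card hc h2 h3 h7 j A B d hA hB hj0 hj1 hj hd]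
  congr 1
  apply Finset.card_bij (fun p _ => p.2)
  · rintro ⟨d', v⟩ hp
    simp only [Spar, Finset.mem_filter, Finset.mem_univ, true_and] at hp ⊢
    obtain ⟨hp, rfl⟩ := hp
    exact hp
  · rintro ⟨d', v⟩ hp ⟨d'', v'⟩ hp' h
    simp only [Finset.mem_filter] at hp hp'
    simp only at h
    rw [hp.2, hp'.2, h]
  · intro v hv
    refine ⟨(d, v), ?_, rfl⟩
    simpa [Spar] using hv

lemma Spar_twist (hc : ringChar K ≠ 2) (h2 : (2 : K) ≠ 0) (h3 : (3 : K) ≠ 0) (h7 : (7 : K) ≠ 0)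
    (j A B ν : K) (hA : A ≠ 0) (hB : B ≠ 0) (hj0 : j ≠ 0) (hj1 : j ≠ 1728)
    (hj : 1728 * (4 * A ^ 3) = j * (4 * A ^ 3 + 27 * B ^ 2)) (hν : quadraticChar K ν = -1) :
    (Spar A B).card + (Spar (A * ν ^ 2) (B * ν ^ 3)).card = 2 * (RH j).card := by
  have hν0 : ν ≠ 0 := by rintro rfl; simp at hν
  have h1 := Spar_card hc h2 h3 h7 j A B hA hB hj0 hj1 hj
  have h2 := Spar_card hc h2 h3 h7 j (A * ν ^ 2) (B * ν ^ 3) (mul_ne_zero hA (pow_ne_zero _ hν0))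
    (mul_ne_zero hB (pow_ne_zero _ hν0)) hj0 hj1 (by linear_combination ν ^ 6 * hj)
  zify
  rw [h1, h2, ← Finset.sum_add_distrib]
  rw [Finset.sum_congr rfl (g := fun _ => (2 : ℤ))]
  · simp [mul_comm]
  intro d _
  have e : B * ν ^ 3 * (-27 * tc4 d) / (-54 * tc6 d * (A * ν ^ 2)) =
     (B * (-27 * tc4 d) / ((-54 * tc6 d) * A)) * ν := by
    rw [show B * ν ^ 3 * (-27 * tc4 d) = (B * (-27 * tc4 d) * ν) * ν ^ 2 by ring,
      show -54 * tc6 d * (A * ν ^ 2) = (-54 * tc6 d * A) * ν ^ 2 by ring,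
      mul_div_mul_right _ _ (pow_ne_zero 2 hν0)]
    ring
  rw [e, map_mul, hν]; ring

lemma RH_card_le (j : K) : (RH j).card ≤ 24 := by
  let H : K[X] := ((X^2 - X + 1) * (X^6 - 11*X^5 + 30*X^4 - 15*X^3 - 10*X^2 + 5*X + 1)) ^ 3
    - C j * (X^7 * (X-1)^7 * (X^3 - 8*X^2 + 5*X + 1))
  have he : ∀ d, H.eval d = tc4 d ^ 3 - j * tD d := by
    intro d; simp [H, tc4, tD]
  have h0 : H ≠ 0 := by
    intro h
    have := he 0
    rw [h] at this
    simp [tc4, tD] at this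
  have hdeg : H.natDegree ≤ 24 := by
    simp only [H]; compute_degree
  calc (RH j).card ≤ H.roots.toFinset.card := by
        apply Finset.card_le_card
        intro d hd
        simp only [RH, Finset.mem_filter, Finset.mem_univ, true_and] at hd
        rw [Multiset.mem_toFinset, mem_roots h0, IsRoot, he, hd, sub_self]
    _ ≤ H.roots.card := Multiset.toFinset_card_le _
    _ ≤ H.natDegree := card_roots' _
    _ ≤ 24 := hdeg

lemma tors_card (h2 : (2 : K) ≠ 0) (h3 : (3 : K) ≠ 0) (A B : K) (hD : 4 * A ^ 3 + 27 * B ^ 2 ≠ 0) :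
    Nat.card (nsmulAddMonoidHom (α := (SW A B).Point) 7).ker = (Spar A B).card + 1 := by
  have hf : Finite (SW A B).Point := SW_finite A B
  have hns : ∀ d v : K, A = -27 * tc4 d * v ^ 4 → B = -54 * tc6 d * v ^ 6 →
      (SW A B).Nonsingular (3 * tb2 d * v^2) (-108 * (d^3 - d^2) * v ^ 3) := by
    intro d v ha hb
    rw [SW_ns h2 A B hD, tor_eqn, ← ha, ← hb]
  have hm : ∀ p : Spar A B, p.1.2 ≠ 0 ∧
      A = -27 * tc4 p.1.1 * p.1.2 ^ 4 ∧ B = -54 * tc6 p.1.1 * p.1.2 ^ 6 := by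
    intro p
    have := p.2
    simpa only [Spar, Finset.mem_filter, Finset.mem_univ, true_and] using this
  let f : Option (Spar A B) → (nsmulAddMonoidHom (α := (SW A B).Point) 7).ker := fun o =>
    match o with
    | none => 0
    | some p => ⟨.some _ _ (hns p.1.1 p.1.2 (hm p).2.1 (hm p).2.2), by
        rw [AddMonoidHom.mem_ker]
        exact tor7 h2 h3 A B _ _ (hm p).1 (hm p).2.1 (hm p).2.2 hD _⟩
  have hb : Function.Bijective f := by
    constructor
    · rintro (_ | p) (_ | q) h
      · rfl
      · have := congrArg Subtype.val h
        simp only [f] at this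
        exact absurd this.symm (WeierstrassCurve.Affine.Point.some_ne_zero _)
      · have := congrArg Subtype.val h
        simp only [f] at this
        exact absurd this (WeierstrassCurve.Affine.Point.some_ne_zero _)
      · have := congrArg Subtype.val h
        simp only [f, WeierstrassCurve.Affine.Point.some.injEq] at this
        have := tor_inj h2 h3 A B _ _ _ _ (hm p).1 (hm q).1 (hm p).2.1 (hm p).2.2
          (hm q).2.1 (hm q).2.2 hD this.1 this.2
        congr 1
        exact Subtype.ext (Prod.ext this.1 this.2)
    · rintro ⟨P, hP⟩
      by_cases h0 : P = 0
      · exact ⟨none, Subtype.ext h0.symm⟩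
      · rw [AddMonoidHom.mem_ker] at hP
        obtain ⟨d, v, hv, ha, hb, h, rfl⟩ := tor_surj h2 h3 A B hD P h0 hP
        refine ⟨some ⟨(d, v), ?_⟩, rfl⟩
        simp only [Spar, Finset.mem_filter, Finset.mem_univ, true_and]
        exact ⟨hv, ha, hb⟩
  rw [← Nat.card_congr (Equiv.ofBijective f hb)]
  simp

lemma ker7_pow {G : Type*} [AddCommGroup G] [Finite G] (h : 7 ∣ Nat.card G) :
    ∃ k, Nat.card (nsmulAddMonoidHom (α := G) 7).ker = 7 ^ (k + 1) := by
  have : Fact (Nat.Prime 7) := ⟨by norm_num⟩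
  let T := (nsmulAddMonoidHom (α := G) 7).ker
  have hT : ∀ x : T, 7 • x = 0 := by
    rintro ⟨x, hx⟩
    rw [AddMonoidHom.mem_ker] at hx
    exact Subtype.ext hx
  letI : Module (ZMod 7) T := AddCommGroup.zmodModule hT
  letI : Fintype T := Fintype.ofFinite T
  have hc : Nat.card T = 7 ^ Module.finrank (ZMod 7) T := by
    rw [Nat.card_eq_fintype_card, Module.card_eq_pow_finrank (K := ZMod 7), ZMod.card]
  obtain ⟨x, hx⟩ := exists_prime_addOrderOf_dvd_card' 7 h
  have hx7 : x ∈ T := by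
    rw [AddMonoidHom.mem_ker]
    show 7 • x = 0
    rw [← hx]; exact addOrderOf_nsmul_eq_zero x
  have hx0 : x ≠ 0 := by rintro rfl; simp at hx
  have hnt : 1 < Nat.card T := by
    rw [Finite.one_lt_card_iff_nontrivial]
    exact ⟨⟨x, hx7⟩, 0, fun h => hx0 (congrArg Subtype.val h)⟩
  rcases h0 : Module.finrank (ZMod 7) T with _ | k
  · rw [hc, h0] at hnt; simp at hnt
  · exact ⟨k, by rw [← h0]; exact hc⟩

lemma RH_card (hc : ringChar K ≠ 2) (h2 : (2 : K) ≠ 0) (h3 : (3 : K) ≠ 0) (h7 : (7 : K) ≠ 0)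
    (j A B : K) (hA : A ≠ 0) (hB : B ≠ 0) (hj0 : j ≠ 0) (hj1 : j ≠ 1728)
    (hj : 1728 * (4 * A ^ 3) = j * (4 * A ^ 3 + 27 * B ^ 2)) (hD : 4 * A ^ 3 + 27 * B ^ 2 ≠ 0)
    (hS : ∑ x : K, quadraticChar K (x ^ 3 + A * x + B) = 0) (hq : 7 ∣ Fintype.card K + 1) :
    (RH j).card = 6 := by
  obtain ⟨ν, hν⟩ := quadraticChar_exists_neg_one hc
  have hν0 : ν ≠ 0 := by rintro rfl; simp at hν
  have hf : Finite (SW A B).Point := SW_finite A B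
  have hf' : Finite (SW (A * ν ^ 2) (B * ν ^ 3)).Point := SW_finite _ _
  have hD' : 4 * (A * ν ^ 2) ^ 3 + 27 * (B * ν ^ 3) ^ 2 ≠ 0 := by
    rw [show 4 * (A * ν ^ 2) ^ 3 + 27 * (B * ν ^ 3) ^ 2 = (4 * A ^ 3 + 27 * B ^ 2) * ν ^ 6 by ring]
    exact mul_ne_zero hD (pow_ne_zero _ hν0)
  have c1 := SW_card hc A B hD
  have c2 := SW_card hc _ _ hD'
  have hS' : ∑ x : K, quadraticChar K (x ^ 3 + (A * ν ^ 2) * x + B * ν ^ 3) = 0 := by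
    rw [← Equiv.sum_comp (Equiv.mulRight₀ ν hν0)]
    have : ∀ x : K, quadraticChar K ((Equiv.mulRight₀ ν hν0 x) ^ 3 +
        (A * ν ^ 2) * (Equiv.mulRight₀ ν hν0 x) + B * ν ^ 3) =
        quadraticChar K (x ^ 3 + A * x + B) * (quadraticChar K ν) ^ 3 := by
      intro x
      rw [← map_pow (quadraticChar K) ν 3, ← map_mul (quadraticChar K)]
      congr 1
      simp only [Equiv.mulRight₀_apply]
      ring
    rw [Finset.sum_congr rfl (fun x _ => this x), ← Finset.sum_mul, hS, zero_mul]
  rw [hS, add_zero] at c1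
  rw [hS', add_zero] at c2
  have d1 : 7 ∣ Nat.card (SW A B).Point := by
    have : Nat.card (SW A B).Point = Fintype.card K + 1 := by exact_mod_cast c1
    rw [this]; exact hq
  have d2 : 7 ∣ Nat.card (SW (A * ν ^ 2) (B * ν ^ 3)).Point := by
    have : Nat.card (SW (A * ν ^ 2) (B * ν ^ 3)).Point = Fintype.card K + 1 := by exact_mod_cast c2
    rw [this]; exact hq
  obtain ⟨k1, e1⟩ := ker7_pow d1
  obtain ⟨k2, e2⟩ := ker7_pow d2
  rw [tors_card h2 h3 A B hD] at e1
  rw [tors_card h2 h3 _ _ hD'] at e2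
  have tw := Spar_twist hc h2 h3 h7 j A B ν hA hB hj0 hj1 hj hν
  have le := RH_card_le j
  generalize (Spar A B).card = s1 at *
  generalize (Spar (A * ν ^ 2) (B * ν ^ 3)).card = s2 at *
  rcases k1 with _ | k1 <;> rcases k2 with _ | k2
  · omega
  · have : 0 < 7 ^ k2 := by positivity
    rw [pow_succ, pow_succ] at e2; omega
  · have : 0 < 7 ^ k1 := by positivity
    rw [pow_succ, pow_succ] at e1; omega
  · have : 0 < 7 ^ k1 := by positivity
    rw [pow_succ, pow_succ] at e1; omega
end

def gc4 {K : Type*} [CommRing K] (x : K) : K :=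
  (x^2 - x + 1) * (x^6 + 229*x^5 + 270*x^4 - 1695*x^3 + 1430*x^2 - 235*x + 1)
def gD {K : Type*} [CommRing K] (x : K) : K := x * (x-1) * (x^3 - 8*x^2 + 5*x + 1) ^ 7

lemma gcop {K : Type*} [Field K] (h7 : (7 : K) ≠ 0) (d : K) (h4 : gc4 d = 0) : gD d ≠ 0 := by
  intro h
  have h' : d = 0 ∨ d = 1 ∨ d^3 - 8*d^2 + 5*d + 1 = 0 := by
    simp only [gD] at h
    rcases mul_eq_zero.1 h with h | h
    · rcases mul_eq_zero.1 h with h | h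
      · exact Or.inl h
      · exact Or.inr (Or.inl (sub_eq_zero.1 h))
    · exact Or.inr (Or.inr (pow_eq_zero_iff (by norm_num) |>.1 h))
  rcases h' with rfl | rfl | h'
  · simp [gc4] at h4
  · simp [gc4] at h4; norm_num at h4
  · apply pow_ne_zero 6 h7
    simp only [gc4] at h4
    linear_combination ((1710) + (3005)*d^1 + (-444)*d^2) * h4 + ((115939) + (-179140)*d^1 + (-316024)*d^2 + (665547)*d^3 + (-645733)*d^4 + (143810)*d^5 + (101779)*d^6 + (444)*d^7) * h'

section
variable {K : Type*} [Field K]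

lemma mob_c4 (r x D m : K) (hr : r^3 - 8*r^2 + 5*r + 1 = 0) (hD : D = x - r)
    (hm : m * D = r * x + 1 - r) :
    tc4 m * D ^ 8 = (r^2 - r + 1) * (44*r^2 - 31*r - 6) * gc4 x := by
  have e1 : (m^2 - m + 1) * D^2 = (r^2 - r + 1) * (x^2 - x + 1) := by
    have : (m^2 - m + 1) * D^2 = (m*D)^2 - (m*D)*D + D^2 := by ring
    rw [this, hm, hD]; ring
  have e2 : (m^6 - 11*m^5 + 30*m^4 - 15*m^3 - 10*m^2 + 5*m + 1) * D^6 = (44*r^2 - 31*r - 6) *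
      (x^6 + 229*x^5 + 270*x^4 - 1695*x^3 + 1430*x^2 - 235*x + 1) := by
    have : (m^6 - 11*m^5 + 30*m^4 - 15*m^3 - 10*m^2 + 5*m + 1) * D^6 =
      (m*D)^6 - 11*(m*D)^5*D + 30*(m*D)^4*D^2 - 15*(m*D)^3*D^3 - 10*(m*D)^2*D^4 + 5*(m*D)*D^5
        + D^6 := by ring
    rw [this, hm, hD]
    linear_combination ((7)*r^0*x^0 + (-1421)*r^0*x^1 + (8610)*r^0*x^2 + (-10185)*r^0*x^3 + (1610)*r^0*x^4 + (1379)*r^0*x^5 + (7)*r^0*x^6 + (1)*r^1*x^0 + (-179)*r^1*x^1 + (1150)*r^1*x^2 + (-1415)*r^1*x^3 + (270)*r^1*x^4 + (173)*r^1*x^5 + (1)*r^1*x^6 + (-3)*r^2*x^0 + (-23)*r^2*x^1 + (190)*r^2*x^2 + (-235)*r^2*x^3 + (30)*r^2*x^4 + (41)*r^2*x^5 + (-3)*r^2*x^6 + (1)*r^3*x^0 + (-11)*r^3*x^1 + (30)*r^3*x^2 + (-15)*r^3*x^3 + (-10)*r^3*x^4 + (5)*r^3*x^5 + (1)*r^3*x^6)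 * hr
  simp only [tc4, gc4]
  calc _ = ((m^2 - m + 1) * D^2) *
        ((m^6 - 11*m^5 + 30*m^4 - 15*m^3 - 10*m^2 + 5*m + 1) * D^6) := by ring
    _ = _ := by rw [e1, e2]; ring

lemma mob_D (r x D m : K) (hr : r^3 - 8*r^2 + 5*r + 1 = 0) (hD : D = x - r)
    (hm : m * D = r * x + 1 - r) :
    tD m * D ^ 24 = (r^2 - r) ^ 7 * (49 * (r^2 - r)) * gD x := by
  have e1 : m * (m - 1) * D^3 = (r^2 - r) * (x^3 - 8*x^2 + 5*x + 1) := by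
    have : m * (m - 1) * D^3 = (m*D) * (m*D - D) * D := by ring
    rw [this, hm, hD]
    linear_combination (x - x^2) * hr
  have e2 : (m^3 - 8*m^2 + 5*m + 1) * D^3 = 49 * (r^2 - r) * (x * (x - 1)) := by
    have : (m^3 - 8*m^2 + 5*m + 1) * D^3 = (m*D)^3 - 8*(m*D)^2*D + 5*(m*D)*D^2 + D^3 := by ring
    rw [this, hm, hD]
    linear_combination (1 - 8*x + 5*x^2 + x^3) * hr
  simp only [tD, gD]
  calc _ = (m * (m - 1) * D^3) ^ 7 * ((m^3 - 8*m^2 + 5*m + 1) * D^3) := by ring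
    _ = _ := by rw [e1, e2]; ring

lemma mob_kap (r : K) (hr : r^3 - 8*r^2 + 5*r + 1 = 0) :
    ((r^2 - r + 1) * (44*r^2 - 31*r - 6)) ^ 3 = (r^2 - r) ^ 7 * (49 * (r^2 - r)) := by
  linear_combination ((-216)*r^0 + (-1620)*r^1 + (2574)*r^2 + (12761)*r^3 + (-60664)*r^4 + (131034)*r^5 + (-176530)*r^6 + (161886)*r^7 + (-99774)*r^8 + (37605)*r^9 + (-6223)*r^10 + (-1127)*r^11 + (-49)*r^13) * hr

lemma mob_k1 (h7 : (7 : K) ≠ 0) (r : K) (hr : r^3 - 8*r^2 + 5*r + 1 = 0) : r^2 - r + 1 ≠ 0 := by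
  intro h
  apply pow_ne_zero 2 h7
  linear_combination ((44) + (16)*r^1 + (-3)*r^2) * h + (5 + 3 * r) * hr

lemma mob_k2 (r : K) (hr : r^3 - 8*r^2 + 5*r + 1 = 0) : 44*r^2 - 31*r - 6 ≠ 0 := by
  intro h
  apply one_ne_zero (α := K)
  linear_combination ((37) + (46)*r^1 + (-7)*r^2) * h + (223 + 308 * r) * hr

lemma mob_iff (h7 : (7 : K) ≠ 0) (j r x : K) (hr : r^3 - 8*r^2 + 5*r + 1 = 0) (hx : x - r ≠ 0) :
    tc4 ((r * x + 1 - r) / (x - r)) ^ 3 = j * tD ((r * x + 1 - r) / (x - r)) ↔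
      gc4 x ^ 3 = j * gD x := by
  obtain ⟨m, hm'⟩ : ∃ m, m = (r * x + 1 - r) / (x - r) := ⟨_, rfl⟩
  have hm : m * (x - r) = r * x + 1 - r := by rw [hm']; field_simp
  rw [← hm']
  have a := mob_c4 r x (x - r) m hr rfl hm
  have b := mob_D r x (x - r) m hr rfl hm
  have k := mob_kap r hr
  have key : (tc4 m ^ 3 - j * tD m) * (x - r) ^ 24 =
      ((r^2 - r + 1) * (44*r^2 - 31*r - 6)) ^ 3 * (gc4 x ^ 3 - j * gD x) := by
    calc _ = (tc4 m * (x - r) ^ 8) ^ 3 - j * (tD m * (x - r) ^ 24) := by ring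
      _ = _ := by rw [a, b, ← k]; ring
  have hk : ((r^2 - r + 1) * (44*r^2 - 31*r - 6)) ^ 3 ≠ 0 :=
    pow_ne_zero _ (mul_ne_zero (mob_k1 h7 r hr) (mob_k2 r hr))
  have hx' : (x - r) ^ 24 ≠ 0 := pow_ne_zero _ hx
  rw [← sub_eq_zero, ← sub_eq_zero (a := gc4 x ^ 3)]
  constructor
  · intro h
    rw [h, zero_mul, eq_comm] at key
    exact (mul_eq_zero.1 key).resolve_left hk
  · intro h
    rw [h, mul_zero] at key
    exact (mul_eq_zero.1 key).resolve_right hx'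

variable [Fintype K] [DecidableEq K]
def RG (j : K) : Finset K := Finset.univ.filter (fun d : K => gc4 d ^ 3 = j * gD d)

lemma RG_card (h7 : (7 : K) ≠ 0) (j r : K) (hr : r^3 - 8*r^2 + 5*r + 1 = 0) :
    (RG j).card = (RH j).card := by
  have hk := mob_k1 h7 r hr
  have hG : ∀ x ∈ RG j, x - r ≠ 0 := by
    intro x hx h
    obtain rfl : x = r := sub_eq_zero.1 h
    simp only [RG, Finset.mem_filter, Finset.mem_univ, true_and] at hx
    have hD : gD x = 0 := by simp only [gD, hr]; ring
    refine gcop h7 x ?_ hD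
    rw [hD, mul_zero] at hx
    exact pow_eq_zero_iff (by norm_num) |>.1 hx
  have hH : ∀ x ∈ RH j, x - r ≠ 0 := by
    intro x hx h
    obtain rfl : x = r := sub_eq_zero.1 h
    simp only [RH, Finset.mem_filter, Finset.mem_univ, true_and] at hx
    have hD : tD x = 0 := by simp only [tD, hr]; ring
    refine tcop h7 x ?_ hD
    rw [hD, mul_zero] at hx
    exact pow_eq_zero_iff (by norm_num) |>.1 hx
  have hsub : ∀ x, x - r ≠ 0 → (r * x + 1 - r) / (x - r) - r = (r^2 - r + 1) / (x - r) := by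
    intro x hx
    field_simp
    ring
  have hinv : ∀ x, x - r ≠ 0 →
      (r * ((r * x + 1 - r) / (x - r)) + 1 - r) / ((r * x + 1 - r) / (x - r) - r) = x := by
    intro x hx
    rw [hsub x hx, div_eq_iff (div_ne_zero hk hx)]
    field_simp
    ring
  refine Finset.card_bij' (fun x _ => (r * x + 1 - r) / (x - r))
    (fun x _ => (r * x + 1 - r) / (x - r)) ?_ ?_ ?_ ?_
  · intro x hx
    have h := hG x hx
    simp only [RG, RH, Finset.mem_filter, Finset.mem_univ, true_and] at hx ⊢
    exact (mob_iff h7 j r x hr h).2 hx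
  · intro x hx
    have h := hH x hx
    simp only [RG, RH, Finset.mem_filter, Finset.mem_univ, true_and] at hx ⊢
    rw [← mob_iff h7 j r _ hr, hinv x h]
    · exact hx
    · rw [hsub x h]; exact div_ne_zero hk h
  · intro x hx; exact hinv x (hG x hx)
  · intro x hx; exact hinv x (hH x hx)
end

set_option maxHeartbeats 4000000 in
lemma velu_id {R : Type*} [CommRing R] (d t b c B2 F4 F6 V U W q0 q1 q2 p0 p1 p2 v w : R) 
   (hb : b = d^3 - d^2) (hc : c = d^2 - d) (hB2 : B2 = (1-c)^2 - 4*b)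
   (hF4 : F4 = -8*b*(1-c)) (hF6 : F6 = 16*b^2)
   (hp0 : p0 = F4) (hp1 : p1 = 3*(4*b)^2+2*B2*(4*b)+F4) (hp2 : p2 = 3*(4*c)^2+2*B2*(4*c)+F4)
   (hq0 : q0 = F6) (hq1 : q1 = (4*b)^3+B2*(4*b)^2+F4*(4*b)+F6) (hq2 : q2 = (4*c)^3+B2*(4*c)^2+F4*(4*c)+F6)
   (hv : v = 2*p0+2*p1+2*p2) (hw : w = 4*q0 + (4*q1 + 2*(4*b)*p1) + (4*q2+2*(4*c)*p2))
   (hV : V = t*(t-4*b)*(t-4*c))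
   (hU : U = t*V^2 + (2*p0*t+4*q0)*((t-4*b)*(t-4*c))^2 + (2*p1*(t-4*b)+4*q1)*(t*(t-4*c))^2
      + (2*p2*(t-4*c)+4*q2)*(t*(t-4*b))^2)
   (hW : W = V^3 - (2*p0*t+8*q0)*((t-4*b)*(t-4*c))^3 - (2*p1*(t-4*b)+8*q1)*(t*(t-4*c))^3
      - (2*p2*(t-4*c)+8*q2)*(t*(t-4*b))^3) :
   U^3 + B2*U^2*V^2 + (F4-5*v)*U*V^4 + (F6-4*B2*v-7*w)*V^6 = (t^3+B2*t^2+F4*t+F6)*W^2 := by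
  subst hU hW hV hw hv hq0 hq1 hq2 hp0 hp1 hp2 hF6 hF4 hB2 hc hb
  ring

lemma hcf_velu (l : ℕ) [Fact (Nat.Prime l)] (hl : 3 < l) (h2 : (2 : ZMod l) ≠ 0)
    (d b c B2 F4 F6 q0 q1 q2 p0 p1 p2 v w : ZMod l)
    (hb0 : b ≠ 0) (hc0 : c ≠ 0)
    (hb : b = d^3 - d^2) (hc : c = d^2 - d) (hB2 : B2 = (1-c)^2 - 4*b)
    (hF4 : F4 = -8*b*(1-c)) (hF6 : F6 = 16*b^2)
    (hp0 : p0 = F4) (hp1 : p1 = 3*(4*b)^2+2*B2*(4*b)+F4) (hp2 : p2 = 3*(4*c)^2+2*B2*(4*c)+F4)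
    (hq0 : q0 = F6) (hq1 : q1 = (4*b)^3+B2*(4*b)^2+F4*(4*b)+F6)
    (hq2 : q2 = (4*c)^3+B2*(4*c)^2+F4*(4*c)+F6)
    (hv : v = 2*p0+2*p1+2*p2) (hw : w = 4*q0 + (4*q1 + 2*(4*b)*p1) + (4*q2+2*(4*c)*p2))
    (h : hcf l (cub B2 (F4-5*v) (F6-4*B2*v-7*w)) = 0) : hcf l (cub B2 F4 F6) = 0 := by
  obtain ⟨V, hV⟩ : ∃ V : (ZMod l)[X], V = X*(X-4*C b)*(X-4*C c) := ⟨_, rfl⟩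
  obtain ⟨U, hU⟩ : ∃ U : (ZMod l)[X], U = X*V^2
      + (2*C p0*X+4*C q0)*((X-4*C b)*(X-4*C c))^2 + (2*C p1*(X-4*C b)+4*C q1)*(X*(X-4*C c))^2
      + (2*C p2*(X-4*C c)+4*C q2)*(X*(X-4*C b))^2 := ⟨_, rfl⟩
  obtain ⟨W, hW⟩ : ∃ W : (ZMod l)[X], W = V^3
      - (2*C p0*X+8*C q0)*((X-4*C b)*(X-4*C c))^3 - (2*C p1*(X-4*C b)+8*C q1)*(X*(X-4*C c))^3
      - (2*C p2*(X-4*C c)+8*C q2)*(X*(X-4*C b))^3 := ⟨_, rfl⟩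
  have d4 : derivative (4 : (ZMod l)[X]) = 0 := by
    rw [show (4 : (ZMod l)[X]) = C 4 from (map_ofNat C 4).symm]; exact derivative_C
  have d2 : derivative (2 : (ZMod l)[X]) = 0 := by
    rw [show (2 : (ZMod l)[X]) = C 2 from (map_ofNat C 2).symm]; exact derivative_C
  have c2 : (C 2 : (ZMod l)[X]) = 2 := map_ofNat C 2
  have hWd : derivative U * V - 2 * U * derivative V = W := by
    rw [hW, hU, hV]
    simp only [derivative_add, derivative_sub, derivative_mul, derivative_pow, derivative_X,
      derivative_C, d4, d2, Nat.cast_ofNat, c2]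
    ring
  have id := velu_id (C d) X (C b) (C c) (C B2) (C F4) (C F6) V U W (C q0) (C q1) (C q2)
    (C p0) (C p1) (C p2) (C v) (C w) (by rw [hb]; simp only [map_add, map_sub, map_mul, map_pow, map_neg, map_one, map_ofNat]) (by rw [hc]; simp only [map_add, map_sub, map_mul, map_pow, map_neg, map_one, map_ofNat]) (by rw [hB2]; simp only [map_add, map_sub, map_mul, map_pow, map_neg, map_one, map_ofNat])
    (by rw [hF4]; simp only [map_add, map_sub, map_mul, map_pow, map_neg, map_one, map_ofNat]) (by rw [hF6]; simp only [map_add, map_sub, map_mul, map_pow, map_neg, map_one, map_ofNat]) (by rw [hp0]) (by rw [hp1]; simp only [map_add, map_sub, map_mul, map_pow, map_neg, map_one, map_ofNat]) (by rw [hp2]; simp only [map_add, map_sub, map_mul, map_pow, map_neg, map_one, map_ofNat])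
    (by rw [hq0]) (by rw [hq1]; simp only [map_add, map_sub, map_mul, map_pow, map_neg, map_one, map_ofNat]) (by rw [hq2]; simp only [map_add, map_sub, map_mul, map_pow, map_neg, map_one, map_ofNat]) (by rw [hv]; simp only [map_add, map_sub, map_mul, map_pow, map_neg, map_one, map_ofNat]) (by rw [hw]; simp only [map_add, map_sub, map_mul, map_pow, map_neg, map_one, map_ofNat])
    hV hU hW
  apply hcf_isogeny l hl B2 F4 F6 B2 (F4-5*v) (F6-4*B2*v-7*w) U V ?_ ?_ h
  · rw [hWd]
    intro h0
    have : W.eval 0 = 0 := by rw [h0]; simp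
    rw [hW, hV, hq0, hF6] at this
    simp only [eval_sub, eval_mul, eval_add, eval_pow, eval_X, eval_C, eval_ofNat] at this
    have h' : (2:ZMod l)^7 * b^2 * (2^4 * b * c)^3 = 0 := by linear_combination -this
    refine absurd h' (mul_ne_zero (mul_ne_zero (pow_ne_zero _ h2) (pow_ne_zero _ hb0))
      (pow_ne_zero _ (mul_ne_zero (mul_ne_zero (pow_ne_zero _ h2) hb0) hc0)))
  · rw [hWd]
    simp only [cub]
    rw [← id]
    simp only [map_add, map_sub, map_mul, map_pow, map_neg, map_one, map_ofNat]

lemma cub_short (l : ℕ) [Fact (Nat.Prime l)] (hl : 3 < l) (h3 : (3 : ZMod l) ≠ 0)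
    (a b c A B : ZMod l) (hA : A = b - a^2/3) (hB : B = 2*a^3/27 - a*b/3 + c) :
    hcf l (cub 0 A B) = hcf l (cub a b c) := by
  rw [← hcf_shift l hl a b c (-a/3), cub_comp]
  have h27 : (27 : ZMod l) ≠ 0 := by
    rw [show (27 : ZMod l) = 3^3 by norm_num]; exact pow_ne_zero _ h3
  congr 2
  · field_simp; ring
  · rw [hA]; field_simp; ring
  · rw [hB]; field_simp; ring

lemma no_root_aux (l : ℕ) [Fact (Nat.Prime l)] (hl : 3 < l) (h2 : (2 : ZMod l) ≠ 0)
    (h3 : (3 : ZMod l) ≠ 0) (h7 : (7 : ZMod l) ≠ 0)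
    (j d : ZMod l) (hj0 : j ≠ 0) (hj1 : j ≠ 1728) (hss : Jl l j = 0)
    (hd : gc4 d ^ 3 = j * gD d) (A B : ZMod l) (hA : A = -27 * tc4 d * (3⁻¹) ^ 4)
    (hB : B = -54 * tc6 d * (3⁻¹) ^ 6) : hcf l (cub 0 A B) = 0 := by
  have n4 : gc4 d ≠ 0 := by
    intro h
    rw [h] at hd
    have : j * gD d = 0 := by rw [← hd]; ring
    exact mul_ne_zero hj0 (gcop h7 d h) this
  have nD : gD d ≠ 0 := by
    intro h
    rw [h, mul_zero] at hd
    exact n4 (pow_eq_zero_iff (by norm_num) |>.1 hd)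
  have d0 : d ≠ 0 := by rintro rfl; simp [gD] at nD
  have d1 : d - 1 ≠ 0 := by intro h; simp [gD, h] at nD
  have h27 : (27 : ZMod l) ≠ 0 := by
    rw [show (27 : ZMod l) = 3^3 by norm_num]; exact pow_ne_zero _ h3
  obtain ⟨b, hb⟩ : ∃ b, b = d^3 - d^2 := ⟨_, rfl⟩
  obtain ⟨c, hc⟩ : ∃ c, c = d^2 - d := ⟨_, rfl⟩
  have hb0 : b ≠ 0 := by
    rw [hb, show d^3-d^2 = d^2 * (d-1) by ring]; exact mul_ne_zero (pow_ne_zero _ d0) d1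
  have hc0 : c ≠ 0 := by
    rw [hc, show d^2-d = d * (d-1) by ring]; exact mul_ne_zero d0 d1
  obtain ⟨B2, hB2⟩ : ∃ y, y = (1-c)^2 - 4*b := ⟨_, rfl⟩
  obtain ⟨F4, hF4⟩ : ∃ y, y = -8*b*(1-c) := ⟨_, rfl⟩
  obtain ⟨F6, hF6⟩ : ∃ y, y = 16*b^2 := ⟨_, rfl⟩
  obtain ⟨p1, hp1⟩ : ∃ y, y = 3*(4*b)^2+2*B2*(4*b)+F4 := ⟨_, rfl⟩
  obtain ⟨p2, hp2⟩ : ∃ y, y = 3*(4*c)^2+2*B2*(4*c)+F4 := ⟨_, rfl⟩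
  obtain ⟨q1, hq1⟩ : ∃ y, y = (4*b)^3+B2*(4*b)^2+F4*(4*b)+F6 := ⟨_, rfl⟩
  obtain ⟨q2, hq2⟩ : ∃ y, y = (4*c)^3+B2*(4*c)^2+F4*(4*c)+F6 := ⟨_, rfl⟩
  obtain ⟨v, hv⟩ : ∃ y, y = 2*F4+2*p1+2*p2 := ⟨_, rfl⟩
  obtain ⟨w, hw⟩ : ∃ y, y = 4*F6 + (4*q1 + 2*(4*b)*p1) + (4*q2+2*(4*c)*p2) := ⟨_, rfl⟩
  rw [cub_short l hl h3 B2 F4 F6 A B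
    (by rw [hA, hF4, hB2, hb, hc]; simp only [tc4]; field_simp; ring)
    (by rw [hB, hF6, hF4, hB2, hb, hc]; simp only [tc6, tb2]; field_simp; ring)]
  apply hcf_velu l hl h2 d b c B2 F4 F6 F6 q1 q2 F4 p1 p2 v w hb0 hc0 hb hc hB2 hF4 hF6 rfl hp1 hp2
    rfl hq1 hq2 hv hw
  rw [← cub_short l hl h3 _ _ _ _ _ rfl rfl]
  have eA : F4 - 5*v - B2^2/3 = - gc4 d / 3 := by
    rw [hv, hp1, hp2, hF4, hB2, hb, hc]; simp only [gc4]; field_simp; ring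
  obtain ⟨B', hB'⟩ : ∃ y, y = 2*B2^3/27 - B2*(F4-5*v)/3 + (F6-4*B2*v-7*w) := ⟨_, rfl⟩
  have eB : 27 * B' = 2*B2^3 - 9*B2*(F4-5*v) + 27*(F6-4*B2*v-7*w) := by
    rw [hB']; field_simp; ring
  rw [eA, ← hB']
  apply hcf_zero_of_Jl l hl j _ _ _ hj0 hj1 _ hss
  · exact div_ne_zero (neg_ne_zero.2 n4) h3
  · have disc : -4 * gc4 d ^ 3 + 27 * B' ^ 2 * 27 = -256 * 27 * gD d := by
      have : -4 * gc4 d ^ 3 + (27 * B') ^ 2 = -256 * 27 * gD d := by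
        rw [eB, hv, hw, hp1, hp2, hq1, hq2, hF6, hF4, hB2, hb, hc]; simp only [gc4, gD]; ring
      linear_combination this
    have e3 : 27 * (-gc4 d / 3) ^ 3 = - gc4 d ^ 3 := by field_simp; ring
    apply mul_left_cancel₀ h27
    linear_combination (1728 * 4 - 4 * j) * e3 - j * disc - 6912 * hd

lemma no_root (l : ℕ) [Fact (Nat.Prime l)] (hl : 3 < l) (h2 : (2 : ZMod l) ≠ 0)
    (h3 : (3 : ZMod l) ≠ 0) (h7 : (7 : ZMod l) ≠ 0) (hl7 : ¬ 7 ∣ l + 1)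
    (j d : ZMod l) (hj0 : j ≠ 0) (hj1 : j ≠ 1728) (hss : Jl l j = 0) :
    gc4 d ^ 3 ≠ j * gD d := by
  intro hd
  obtain ⟨A, hA⟩ : ∃ A, A = -27 * tc4 d * (3⁻¹) ^ 4 := ⟨_, rfl⟩
  obtain ⟨B, hB⟩ : ∃ B, B = -54 * tc6 d * (3⁻¹) ^ 6 := ⟨_, rfl⟩
  have hcf0 := no_root_aux l hl h2 h3 h7 j d hj0 hj1 hss hd A B hA hB
  have hs := charsum_zero l hl 0 A B hcf0
  simp only [cub_eval] at hs
  have hs' : ∑ x : ZMod l, quadraticChar (ZMod l) (x ^ 3 + A * x + B) = 0 := by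
    rw [← hs]; apply Finset.sum_congr rfl; intro x _; congr 1; ring
  have nD : gD d ≠ 0 := by
    intro h
    rw [h, mul_zero] at hd
    exact gcop h7 d (pow_eq_zero_iff (by norm_num) |>.1 hd) h
  have i3 : (3⁻¹ : ZMod l) ≠ 0 := inv_ne_zero h3
  have hD : 4 * A ^ 3 + 27 * B ^ 2 ≠ 0 := by
    rw [hA, hB, tD_disc]
    have hm := nD
    simp only [gD] at hm
    have m1 := left_ne_zero_of_mul hm
    have m2 := right_ne_zero_of_mul hm
    have m3 := left_ne_zero_of_mul m1
    have m4 := right_ne_zero_of_mul m1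
    have m5 : d^3 - 8*d^2 + 5*d + 1 ≠ 0 := fun h => m2 (by rw [h]; ring)
    refine mul_ne_zero (mul_ne_zero (neg_ne_zero.2 (mul_ne_zero (pow_ne_zero _ h2)
      (pow_ne_zero _ h3))) ?_) (pow_ne_zero _ i3)
    exact mul_ne_zero (mul_ne_zero (pow_ne_zero _ m3) (pow_ne_zero _ m4)) m5
  have hns : (SW A B).Nonsingular (3 * tb2 d * (3⁻¹)^2) (-108 * (d^3 - d^2) * (3⁻¹) ^ 3) := by
    rw [SW_ns h2 A B hD, hA, hB]; exact tor_eqn d _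
  have t7 := tor7 h2 h3 A B d 3⁻¹ i3 hA hB hD hns
  have : Finite (SW A B).Point := SW_finite A B
  have hc : ringChar (ZMod l) ≠ 2 := by
    rw [ZMod.ringChar_zmod_n]; omega
  have cd := SW_card hc A B hD
  rw [hs', add_zero, ZMod.card] at cd
  have cd' : Nat.card (SW A B).Point = l + 1 := by exact_mod_cast cd
  have : Fact (Nat.Prime 7) := ⟨by norm_num⟩
  have ho := addOrderOf_eq_prime t7 (WeierstrassCurve.Affine.Point.some_ne_zero _)
  apply hl7
  rw [← cd', ← ho]
  exact addOrderOf_dvd_natCard _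

lemma natCast_ne (l : ℕ) [Fact (Nat.Prime l)] (K : Type*) [Field K] [Algebra (ZMod l) K]
    (n : ℕ) (hn : Nat.Prime n) (h : l ≠ n) : (n : K) ≠ 0 := by
  have hch : CharP K l := charP_of_injective_algebraMap (algebraMap (ZMod l) K).injective l
  rw [Ne, CharP.cast_eq_zero_iff K l]
  intro hd
  exact h ((Nat.prime_dvd_prime_iff_eq Fact.out hn).1 hd)

lemma Gxj_aeval (l : ℕ) [Fact (Nat.Prime l)] {K : Type*} [Field K] [Algebra (ZMod l) K]
    (j : ZMod l) (x : K) : aeval x (Gxj l j) = gc4 x ^ 3 - algebraMap (ZMod l) K j * gD x := by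
  simp only [Gxj, gc4, gD, map_sub, map_mul, map_add, map_pow, aeval_X, aeval_C, map_one,
    map_ofNat, mul_pow]

/-- the number of roots over the cubic extension -/
lemma six_roots (l : ℕ) [Fact (Nat.Prime l)] (hl : 3 < l) (h7 : l % 7 = 3 ∨ l % 7 = 5)
    (j : ZMod l) (hj0 : j ≠ 0) (hj1 : j ≠ 1728) (hss : Jl l j = 0)
    {K : Type*} [Field K] [Fintype K] [DecidableEq K] [Algebra (ZMod l) K]
    (hK : Fintype.card K = l ^ 3) : (RG (algebraMap (ZMod l) K j)).card = 6 := by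
  have hch : CharP K l := charP_of_injective_algebraMap (algebraMap (ZMod l) K).injective l
  have l7 : l ≠ 7 := by rintro rfl; omega
  have k2 : (2 : K) ≠ 0 := by exact_mod_cast natCast_ne l K 2 Nat.prime_two (by omega)
  have k3 : (3 : K) ≠ 0 := by exact_mod_cast natCast_ne l K 3 Nat.prime_three (by omega)
  have k7 : (7 : K) ≠ 0 := by exact_mod_cast natCast_ne l K 7 (by norm_num) l7
  have z2 : (2 : ZMod l) ≠ 0 := by exact_mod_cast natCast_ne l (ZMod l) 2 Nat.prime_two (by omega)
  have z3 : (3 : ZMod l) ≠ 0 := by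
    exact_mod_cast natCast_ne l (ZMod l) 3 Nat.prime_three (by omega)
  have hc : ringChar K ≠ 2 := by rw [ringChar.eq K l]; omega
  obtain ⟨r, hr⟩ := cub_root_K l hK (-8) 5 1
  have hr' : r^3 - 8*r^2 + 5*r + 1 = 0 := by
    rw [← hr]; simp only [cub, map_add, map_mul, map_pow, aeval_X, aeval_C, map_neg, map_ofNat,
      map_one]; ring
  rw [RG_card k7 _ r hr']
  have hs : j - 1728 ≠ 0 := sub_ne_zero.2 hj1
  obtain ⟨c0, hc0⟩ : ∃ c0, c0 = j / (j - 1728) := ⟨_, rfl⟩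
  have hc0' : c0 * (j - 1728) = j := by rw [hc0]; field_simp
  have n0 : c0 ≠ 0 := by rw [hc0]; exact div_ne_zero hj0 hs
  have n1 : 1 - c0 ≠ 0 := by
    intro h
    have : (1728 : ZMod l) = 0 := by linear_combination (-(j - 1728)) * h - hc0'
    rw [show (1728 : ZMod l) = 2 ^ 6 * 3 ^ 3 by norm_num] at this
    exact mul_ne_zero (pow_ne_zero _ z2) (pow_ne_zero _ z3) this
  have hjr : 1728 * (4 * (-3 * c0) ^ 3) = j * (4 * (-3 * c0) ^ 3 + 27 * (2 * c0) ^ 2) := by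
    linear_combination (108 * c0 ^ 2) * hc0'
  have nA : -3 * c0 ≠ 0 := mul_ne_zero (neg_ne_zero.2 z3) n0
  have nB : 2 * c0 ≠ 0 := mul_ne_zero z2 n0
  have nD : 4 * (-3 * c0) ^ 3 + 27 * (2 * c0) ^ 2 ≠ 0 := by
    rw [show 4 * (-3 * c0) ^ 3 + 27 * (2 * c0) ^ 2 = 2 ^ 2 * 3 ^ 3 * c0 ^ 2 * (1 - c0) by ring]
    exact mul_ne_zero (mul_ne_zero (mul_ne_zero (pow_ne_zero _ z2) (pow_ne_zero _ z3))
      (pow_ne_zero _ n0)) n1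
  have hcf0 := hcf_zero_of_Jl l hl j _ _ nA hj0 hj1 hjr hss
  have hs0 := charsum_zero l hl 0 _ _ hcf0
  simp only [cub_eval] at hs0
  have hs' : ∑ x : ZMod l, quadraticChar (ZMod l) (x ^ 3 + (-3 * c0) * x + 2 * c0) = 0 := by
    rw [← hs0]; apply Finset.sum_congr rfl; intro x _; congr 1; ring
  have hS := S3_zero l hl hK _ _ hs'
  have inj : ∀ a : ZMod l, a ≠ 0 → algebraMap (ZMod l) K a ≠ 0 := fun a ha => by
    rwa [Ne, map_eq_zero]
  refine RH_card hc k2 k3 k7 _ _ _ (inj _ nA) (inj _ nB) (inj _ hj0) ?_ ?_ ?_ hS ?_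
  · intro h
    apply hj1
    apply (algebraMap (ZMod l) K).injective
    rw [h, map_ofNat]
  · have := congrArg (algebraMap (ZMod l) K) hjr
    simpa only [map_add, map_mul, map_pow, map_ofNat] using this
  · have := inj _ nD
    simpa only [map_add, map_mul, map_pow, map_ofNat] using this
  · rw [hK]
    have : (l ^ 3 + 1) % 7 = 0 := by
      rw [Nat.add_mod, Nat.pow_mod]
      rcases h7 with h | h <;> rw [h]
    exact Nat.dvd_of_mod_eq_zero this

theorem Gxj_two_cubic_factors (l : ℕ) [Fact (Nat.Prime l)] (hl : 3 < l)
    (h7 : l % 7 = 3 ∨ l % 7 = 5)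
    (j : ZMod l) (hj0 : j ≠ 0) (hj1728 : j ≠ 1728) (hss : Jl l j = 0) :
    {p : Polynomial (ZMod l) | p.Monic ∧ Irreducible p ∧ p.natDegree = 3 ∧
        p ∣ Gxj l j}.ncard = 2 ∧
      ∀ x : ZMod l, ¬ (Gxj l j).IsRoot x := by
  classical
  have l7 : l ≠ 7 := by rintro rfl; omega
  have z2 : (2 : ZMod l) ≠ 0 := by exact_mod_cast natCast_ne l (ZMod l) 2 Nat.prime_two (by omega)
  have z3 : (3 : ZMod l) ≠ 0 := by
    exact_mod_cast natCast_ne l (ZMod l) 3 Nat.prime_three (by omega)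
  have z7 : (7 : ZMod l) ≠ 0 := by exact_mod_cast natCast_ne l (ZMod l) 7 (by norm_num) l7
  have hnr : ∀ x : ZMod l, ¬ (Gxj l j).IsRoot x := by
    intro x hx
    have h := Gxj_aeval l j x
    rw [IsRoot, ← coe_aeval_eq_eval, h] at hx
    exact no_root l hl z2 z3 z7 (by omega) j x hj0 hj1728 hss (sub_eq_zero.1 hx)
  refine ⟨?_, hnr⟩
  let K := GaloisField l 3
  letI : Fintype K := Fintype.ofFinite K
  have hK : Fintype.card K = l ^ 3 := by
    rw [← Nat.card_eq_fintype_card]; exact GaloisField.card l 3 (by norm_num)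
  have h6 := six_roots l hl h7 j hj0 hj1728 hss hK
  have hmem : ∀ x : K, x ∈ RG (algebraMap (ZMod l) K j) ↔ aeval x (Gxj l j) = 0 := by
    intro x
    rw [Gxj_aeval, sub_eq_zero]
    simp [RG]
  have hIntg : ∀ x : K, IsIntegral (ZMod l) x := fun x => Algebra.IsIntegral.isIntegral x
  have hfr : Module.finrank (ZMod l) K = 3 := GaloisField.finrank l (by norm_num)
  have hset : {p : Polynomial (ZMod l) | p.Monic ∧ Irreducible p ∧ p.natDegree = 3 ∧
      p ∣ Gxj l j} = ((RG (algebraMap (ZMod l) K j)).image (minpoly (ZMod l)) : Set _) := by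
    ext p
    simp only [Set.mem_setOf_eq, Finset.coe_image, Set.mem_image, Finset.mem_coe]
    constructor
    · rintro ⟨hm, hi, hd, hdv⟩
      obtain ⟨x, hx⟩ := cubic_root_K l hK p hi hd
      refine ⟨x, ?_, (minpoly.eq_of_irreducible_of_monic hi hx hm).symm⟩
      rw [hmem]
      obtain ⟨q, hq⟩ := hdv
      rw [hq, map_mul, hx, zero_mul]
    · rintro ⟨x, hx, rfl⟩
      rw [hmem] at hx
      refine ⟨minpoly.monic (hIntg x), minpoly.irreducible (hIntg x), ?_, minpoly.dvd _ _ hx⟩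
      have hd := minpoly.degree_dvd (hIntg x)
      rw [hfr] at hd
      rcases (Nat.dvd_prime Nat.prime_three).1 hd with h | h
      · rw [minpoly.natDegree_eq_one_iff] at h
        obtain ⟨a, rfl⟩ := h
        exfalso
        apply hnr a
        rw [aeval_algebraMap_apply, map_eq_zero] at hx
        simpa [IsRoot] using hx
      · exact h
  rw [hset, Set.ncard_coe_finset]
  have hcount := Finset.card_eq_sum_card_image (minpoly (ZMod l)) (RG (algebraMap (ZMod l) K j))
  rw [h6] at hcount
  have hfib : ∀ p ∈ (RG (algebraMap (ZMod l) K j)).image (minpoly (ZMod l)),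
      ((RG (algebraMap (ZMod l) K j)).filter (fun x => minpoly (ZMod l) x = p)).card = 3 := by
    intro p hp
    have hp' : p ∈ {p : Polynomial (ZMod l) | p.Monic ∧ Irreducible p ∧ p.natDegree = 3 ∧
      p ∣ Gxj l j} := by rw [hset]; exact hp
    obtain ⟨hm, hi, hd, hdv⟩ := hp'
    obtain ⟨x, hx, hxp⟩ := Finset.mem_image.1 hp
    have hsp : Splits (p.map (algebraMap (ZMod l) K)) := by
      rw [← hxp]; exact Normal.splits inferInstance x
    have hsep : p.Separable := PerfectField.separable_of_irreducible hi
    have hcr := card_rootSet_eq_natDegree hsep hsp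
    rw [hd, ← Set.toFinset_card] at hcr
    refine Eq.trans ?_ hcr
    congr 1
    ext y
    rw [Set.mem_toFinset, mem_rootSet, Finset.mem_filter, hmem]
    constructor
    · rintro ⟨_, rfl⟩
      exact ⟨hm.ne_zero, minpoly.aeval _ _⟩
    · rintro ⟨_, hy⟩
      refine ⟨?_, (minpoly.eq_of_irreducible_of_monic hi hy hm).symm⟩
      obtain ⟨q, hq⟩ := hdv
      rw [hq, map_mul, hy, zero_mul]
  rw [Finset.sum_congr rfl hfib, Finset.sum_const, smul_eq_mul] at hcount
  omega
end

section
/- In the polynomial ring ℤ[X,Y], the resultant with respect to h of the two polynomials G(h,X) = (h²−h+1)³·(h⁶+229h⁵+270h⁴−1695h³+1430h²−235h+1)³ − X·h(h−1)(h³−8h²+5h+1)⁷ (of degree 24 in h) and f₇(h,Y) = (h²−h+1)³ − Y·h(h−1)(h³−8h²+5h+1) (of degree 6 in h) equals 7⁴²·R₇(X,Y)³, where R₇(X,Y) = X² − X·Y·(Y²−21Y+8)(Y⁴−42Y³+454Y²−1008Y−1280) + Y²·(Y²+224Y+448)³. -/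
open Polynomial

/-- The Sylvester matrix of two polynomials `f, g` over a commutative ring,
taken with respect to the degree bounds `m` (for `f`) and `n` (for `g`):
an `(n+m) × (n+m)` matrix whose first `n` rows contain the shifted coefficient
sequences of `f` and whose last `m` rows contain the shifted coefficient
sequences of `g` (in descending order of degree). -/
noncomputable def sylvesterMatrix {R : Type*} [CommRing R] (f g : Polynomial R)
    (m n : ℕ) : Matrix (Fin (n + m)) (Fin (n + m)) R :=
  Matrix.of fun i j =>
    if (i : ℕ) < n then
      if (i : ℕ) ≤ (j : ℕ) ∧ (j : ℕ) ≤ (i : ℕ) + m then f.coeff (m + i - j) else 0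
    else
      if (i : ℕ) - n ≤ (j : ℕ) ∧ (j : ℕ) ≤ ((i : ℕ) - n) + n then
        g.coeff (n + ((i : ℕ) - n) - j) else 0

/-- The resultant of two polynomials with respect to the degree bounds `m`, `n`:
the determinant of their Sylvester matrix. -/
noncomputable def resultantDeg {R : Type*} [CommRing R] (f g : Polynomial R)
    (m n : ℕ) : R :=
  (sylvesterMatrix f g m n).det

/-- The base ring `ℤ[X,Y]`, with `X`, `Y` the two generators. -/
abbrev ZXY : Type := MvPolynomial (Fin 2) ℤ

noncomputable def Xv : ZXY := MvPolynomial.X 0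
noncomputable def Yv : ZXY := MvPolynomial.X 1

/-- `G(h,X)` as a polynomial in `h` over `ℤ[X,Y]`, of degree `24` in `h`. -/
noncomputable def GhX : Polynomial ZXY :=
  (X ^ 2 - X + 1) ^ 3 *
      (X ^ 6 + 229 * X ^ 5 + 270 * X ^ 4 - 1695 * X ^ 3 + 1430 * X ^ 2 - 235 * X + 1) ^ 3
    - C Xv * (X * (X - 1) * (X ^ 3 - 8 * X ^ 2 + 5 * X + 1) ^ 7)

/-- `f₇(h,Y)` as a polynomial in `h` over `ℤ[X,Y]`, of degree `6` in `h`. -/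
noncomputable def f7hY : Polynomial ZXY :=
  (X ^ 2 - X + 1) ^ 3 - C Yv * (X * (X - 1) * (X ^ 3 - 8 * X ^ 2 + 5 * X + 1))

/-- The modular polynomial `R₇(X,Y)` for the Fricke group `Γ₀*(7)`. -/
noncomputable def R7XY : ZXY :=
  Xv ^ 2 - Xv * Yv * (Yv ^ 2 - 21 * Yv + 8) *
      (Yv ^ 4 - 42 * Yv ^ 3 + 454 * Yv ^ 2 - 1008 * Yv - 1280)
    + Yv ^ 2 * (Yv ^ 2 + 224 * Yv + 448) ^ 3


lemma resultantDeg_eq_resultant {R : Type*} [CommRing R] (f g : Polynomial R) (m n : ℕ) :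
    resultantDeg f g m n = Polynomial.resultant f g m n := by
  unfold resultantDeg Polynomial.resultant
  rw [← Matrix.det_transpose (Polynomial.sylvester f g m n),
    ← Matrix.det_submatrix_equiv_self ((finCongr (Nat.add_comm n m)).trans Fin.revPerm)]
  congr 1
  ext i j
  simp only [sylvesterMatrix, Matrix.of_apply, Matrix.submatrix_apply, Matrix.transpose_apply,
    Polynomial.sylvester]
  obtain ⟨k, hk⟩ : ∃ k, k = ((finCongr (Nat.add_comm n m)).trans Fin.revPerm) i := ⟨_, rfl⟩
  have hkv : (k : ℕ) = m + n - 1 - i := by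
    rw [hk]; simp [Fin.val_rev]; omega
  have hjv : ((((finCongr (Nat.add_comm n m)).trans Fin.revPerm) j : Fin (m + n)) : ℕ)
      = m + n - 1 - j := by
    simp [Fin.val_rev]; omega
  rw [← hk]
  have hi := i.2
  have hj := j.2
  induction k using Fin.addCases with
  | left a =>
    have ha := a.2
    simp only [Fin.val_castAdd] at hkv
    simp only [Fin.addCases_left, Set.mem_Icc, hjv]
    rw [if_neg (by omega)]
    split_ifs <;> first | rfl | omega | (congr 1; omega)
  | right a =>
    have ha := a.2
    simp only [Fin.val_natAdd] at hkv
    simp only [Fin.addCases_right, Set.mem_Icc, hjv]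
    rw [if_pos (by omega)]
    split_ifs <;> first | rfl | omega | (congr 1; omega)

section
variable {K : Type*} [Field K]

/-- the cubic `h³ - 8h² + 5h + 1` -/
noncomputable def cP (K : Type*) [Field K] : K[X] := X ^ 3 - 8 * X ^ 2 + 5 * X + 1
/-- the quadratic `h(h-1)` -/
noncomputable def uP (K : Type*) [Field K] : K[X] := X * (X - 1)

lemma cubic_monic (t : K) : (cP K - C t * uP K).Monic := by
  unfold cP uP
  monicity
  all_goals try norm_num

lemma cubic_natDegree (t : K) : (cP K - C t * uP K).natDegree = 3 := by
  unfold cP uP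
  compute_degree!

lemma res_u_cubic (t : K) : resultant (uP K) (cP K - C t * uP K) 2 3 = -1 := by
  have h1 : (X - 1 : K[X]) = X - C 1 := by simp
  have h0 : (X : K[X]) = X - C 0 := by simp
  have hd := (cubic_natDegree t).le
  have := resultant_mul_left (X - C 0) (X - C 1) (cP K - C t * uP K) 3 hd
  rw [natDegree_X_sub_C, natDegree_X_sub_C, resultant_X_sub_C_left _ _ _ hd,
    resultant_X_sub_C_left _ _ _ hd, ← h0, ← h1] at this
  change resultant (X * (X - 1)) _ 2 3 = _
  rw [this]
  simp [cP, uP]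
  norm_num

/-- `t`-form of `G`, evaluated at `t` -/
noncomputable def Pt (x t : K) : K :=
  (t ^ 2 + 13 * t + 49) * (t ^ 2 + 245 * t + 2401) ^ 3 - x * t ^ 7

noncomputable def GK (x : K) : K[X] := (X ^ 2 - X + 1) ^ 3 *
      (X ^ 6 + 229 * X ^ 5 + 270 * X ^ 4 - 1695 * X ^ 3 + 1430 * X ^ 2 - 235 * X + 1) ^ 3
    - C x * (X * (X - 1) * (X ^ 3 - 8 * X ^ 2 + 5 * X + 1) ^ 7)

lemma GK_eq (x : K) : GK x = (cP K ^ 2 + 13 * (cP K * uP K) + 49 * uP K ^ 2) *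
    (cP K ^ 2 + 245 * (cP K * uP K) + 2401 * uP K ^ 2) ^ 3 - C x * (uP K * cP K ^ 7) := by
  have h1 : (X ^ 2 - X + 1 : K[X]) ^ 3 = cP K ^ 2 + 13 * (cP K * uP K) + 49 * uP K ^ 2 := by
    unfold cP uP; ring
  have h2 : (X ^ 6 + 229 * X ^ 5 + 270 * X ^ 4 - 1695 * X ^ 3 + 1430 * X ^ 2 - 235 * X + 1 : K[X])
     = cP K ^ 2 + 245 * (cP K * uP K) + 2401 * uP K ^ 2 := by
    unfold cP uP; ring
  unfold GK
  rw [h1, h2]; rfl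

lemma GK_natDegree (x : K) : (GK x).natDegree ≤ 24 := by
  unfold GK
  compute_degree

lemma dvd_aux {R : Type*} [CommRing R] (c s u x : R) :
    c - s ∣ ((c ^ 2 + 13 * (c * u) + 49 * u ^ 2) *
        (c ^ 2 + 245 * (c * u) + 2401 * u ^ 2) ^ 3 - x * (u * c ^ 7)) -
      ((s ^ 2 + 13 * (s * u) + 49 * u ^ 2) *
        (s ^ 2 + 245 * (s * u) + 2401 * u ^ 2) ^ 3 - x * (u * s ^ 7)) := by
  rw [← Ideal.mem_span_singleton, ← Ideal.Quotient.eq]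
  have h : Ideal.Quotient.mk (Ideal.span {c - s}) c = Ideal.Quotient.mk _ s := by
    rw [Ideal.Quotient.eq]; exact Ideal.mem_span_singleton_self _
  simp only [map_sub, map_mul, map_add, map_pow, h]

lemma form_aux {R : Type*} [CommRing R] (t u x : R) :
    ((t ^ 2 + 13 * t + 49) * (t ^ 2 + 245 * t + 2401) ^ 3 - x * t ^ 7) * u ^ 8 =
      (((t * u) ^ 2 + 13 * ((t * u) * u) + 49 * u ^ 2) *
        ((t * u) ^ 2 + 245 * ((t * u) * u) + 2401 * u ^ 2) ^ 3 - x * (u * (t * u) ^ 7)) := by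
  ring

lemma GK_dvd (x t : K) : (cP K - C t * uP K) ∣ GK x - C (Pt x t) * uP K ^ 8 := by
  have : C (Pt x t) = (C t ^ 2 + 13 * C t + 49) * (C t ^ 2 + 245 * C t + 2401) ^ 3
      - C x * C t ^ 7 := by
    simp only [Pt, map_sub, map_mul, map_add, map_pow, map_ofNat]
  rw [this, form_aux, GK_eq]
  exact dvd_aux _ _ _ _

lemma uP_natDegree : (uP K).natDegree = 2 := by
  unfold uP; compute_degree!

lemma uP_monic : (uP K).Monic := by
  have := (monic_X (R := K)).mul (monic_X_sub_C (1 : K))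
  simpa [uP] using this

lemma res_G_cubic (x t : K) : resultant (GK x) (cP K - C t * uP K) 24 3 = Pt x t ^ 3 := by
  obtain ⟨p, hp⟩ := GK_dvd x t
  have hm := cubic_monic t
  have hd := cubic_natDegree t
  have hup : (uP K ^ 8).natDegree = 16 := by rw [natDegree_pow, uP_natDegree]
  have hu8 : (C (Pt x t) * uP K ^ 8).natDegree ≤ 16 :=
    (natDegree_C_mul_le _ _).trans hup.le
  have hpd : p.natDegree + 3 ≤ 24 := by
    by_cases h0 : p = 0
    · simp [h0]
    have h := hm.natDegree_mul' h0
    rw [← hp, hd] at h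
    have := natDegree_sub_le_of_le (GK_natDegree x) (hu8.trans (by norm_num : 16 ≤ 24))
    simp at this
    omega
  have e : GK x = C (Pt x t) * uP K ^ 8 + (cP K - C t * uP K) * p := by rw [← hp]; ring
  rw [e, resultant_add_mul_left _ _ _ _ _ hpd hd.le, resultant_C_mul_left,
    show (24 : ℕ) = 16 + 8 from rfl, resultant_add_left_deg _ _ _ _ _ hup.le]
  have hc : (cP K - C t * uP K).coeff 3 = 1 := by rw [← hd]; exact hm
  have hpow := resultant_pow_left (uP K) (cP K - C t * uP K) 8 3
    (by rw [uP_monic.leadingCoeff]; simp) hd.le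
  rw [hup, uP_natDegree, res_u_cubic] at hpow
  rw [hpow, hc]
  norm_num

lemma res_G_f7 (x y t₁ t₂ : K) (hs : t₁ + t₂ = y - 13) (hp : t₁ * t₂ = 49) :
    resultant (GK x) ((X ^ 2 - X + 1) ^ 3 - C y * (X * (X - 1) * (X ^ 3 - 8 * X ^ 2 + 5 * X + 1)))
      24 6 = (Pt x t₁ * Pt x t₂) ^ 3 := by
  have hy : y = t₁ + t₂ + 13 := by rw [hs]; ring
  have e : ((X ^ 2 - X + 1) ^ 3 - C y * (X * (X - 1) * (X ^ 3 - 8 * X ^ 2 + 5 * X + 1)) : K[X])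
      = (cP K - C t₁ * uP K) * (cP K - C t₂ * uP K) := by
    have hp' : C t₁ * C t₂ = (49 : K[X]) := by rw [← C_mul, hp]; exact map_ofNat C 49
    have h1 : (X ^ 2 - X + 1 : K[X]) ^ 3 = cP K ^ 2 + 13 * (cP K * uP K) + 49 * uP K ^ 2 := by
      unfold cP uP; ring
    rw [h1, hy]
    change _ - _ * (uP K * cP K) = _
    simp only [C_add, map_ofNat]
    linear_combination (- uP K ^ 2) * hp'
  have h := resultant_mul_right (GK x) (cP K - C t₁ * uP K) (cP K - C t₂ * uP K) 24
    (GK_natDegree x)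
  rw [cubic_natDegree, cubic_natDegree, res_G_cubic, res_G_cubic] at h
  rw [e, mul_pow]
  exact h

lemma Pt_mul (x y t₁ t₂ : K) (hs : t₁ + t₂ = y - 13) (hp : t₁ * t₂ = 49) :
    Pt x t₁ * Pt x t₂ = 7 ^ 14 * (x ^ 2 - x * y * (y ^ 2 - 21 * y + 8) *
      (y ^ 4 - 42 * y ^ 3 + 454 * y ^ 2 - 1008 * y - 1280)
    + y ^ 2 * (y ^ 2 + 224 * y + 448) ^ 3) := by
  have key : ∀ a b : K, a + b = y - 13 → a * b = 49 →
      Pt x a = a ^ 4 * (y * (a + 49 * b + 245) ^ 3 - x * a ^ 3) := by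
    intro a b hs hp
    have h1 : a ^ 2 + 13 * a + 49 = y * a := by linear_combination a * hs - hp
    have h2 : a ^ 2 + 245 * a + 2401 = a * (a + 49 * b + 245) := by linear_combination (-49) * hp
    unfold Pt
    rw [h1, h2]; ring
  have hc : ∀ a b : K, a * b = 49 → (a + 49 * b + 245) * b = 49 * (b ^ 2 + 5 * b + 1) := by
    intro a b hp
    linear_combination hp
  have hs' : t₂ + t₁ = y - 13 := by rw [add_comm, hs]
  have hp' : t₂ * t₁ = 49 := by rw [mul_comm, hp]
  have c₁ := hc t₁ t₂ hp
  have c₂ := hc t₂ t₁ hp'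
  rw [key t₁ t₂ hs hp, key t₂ t₁ hs' hp']
  have hbb : (t₁ + 49 * t₂ + 245) * (t₂ + 49 * t₁ + 245) = 49 * (y ^ 2 + 224 * y + 448) := by
    have : y = t₁ + t₂ + 13 := by rw [hs]; ring
    rw [this]
    linear_combination (2402 - 98) * hp
  have he : (t₂ ^ 2 + 5 * t₂ + 1) + (t₁ ^ 2 + 5 * t₁ + 1) = y ^ 2 - 21 * y + 8 := by
    have : y = t₁ + t₂ + 13 := by rw [hs]; ring
    rw [this]
    linear_combination (-2) * hp
  have hm : (t₂ ^ 2 + 5 * t₂ + 1) * (t₁ ^ 2 + 5 * t₁ + 1) =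
      2401 + 245 * (y - 13) + 25 * 49 + ((y - 13) ^ 2 - 98) + 5 * (y - 13) + 1 := by
    rw [← hs]
    linear_combination (t₁ * t₂ + 49 + 5 * (t₁ + t₂) + 25 - 2) * hp
  generalize t₁ + 49 * t₂ + 245 = b₁ at *
  generalize t₂ + 49 * t₁ + 245 = b₂ at *
  generalize t₂ ^ 2 + 5 * t₂ + 1 = e₂ at *
  generalize t₁ ^ 2 + 5 * t₁ + 1 = e₁ at *
  have main : t₁ ^ 4 * (y * b₁ ^ 3 - x * t₁ ^ 3) * (t₂ ^ 4 * (y * b₂ ^ 3 - x * t₂ ^ 3)) =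
      (t₁ * t₂) ^ 4 * (y ^ 2 * (b₁ * b₂) ^ 3 - x * y * ((b₁ * t₂) ^ 3 + (b₂ * t₁) ^ 3)
        + x ^ 2 * (t₁ * t₂) ^ 3) := by ring
  rw [main, hp, hbb, c₁, c₂]
  have hcube : (49 * e₂) ^ 3 + (49 * e₁) ^ 3 =
      49 ^ 3 * ((e₂ + e₁) * ((e₂ + e₁) ^ 2 - 3 * (e₂ * e₁))) := by ring
  rw [hcube, he, hm]
  ring

end

/-- `Res_h(G(h,X), f₇(h,Y)) = 7⁴² · R₇(X,Y)³` in `ℤ[X,Y]`. -/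
theorem resultant_GhX_f7hY : resultantDeg GhX f7hY 24 6 = 7 ^ 42 * R7XY ^ 3 := by
  rw [resultantDeg_eq_resultant]
  let K := AlgebraicClosure (FractionRing ZXY)
  let φ : ZXY →+* K :=
    (algebraMap (FractionRing ZXY) K).comp (algebraMap ZXY (FractionRing ZXY))
  have hφ : Function.Injective φ := 
    (algebraMap (FractionRing ZXY) K).injective.comp (IsFractionRing.injective ZXY _)
  apply hφ
  rw [← resultant_map_map]
  set x := φ Xv with hx
  set y := φ Yv with hy
  obtain ⟨t, ht⟩ : ∃ t : K, t ^ 2 + (13 - y) * t + 49 = 0 := by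
    obtain ⟨t, ht⟩ := IsAlgClosed.exists_root (X ^ 2 + C (13 - y) * X + 49 : K[X]) (by
      have : (X ^ 2 + C (13 - y) * X + 49 : K[X]).degree = 2 := by compute_degree!
      rw [this]; norm_num)
    exact ⟨t, by simpa [IsRoot] using ht⟩
  have hG : GhX.map φ = GK x := by
    simp [GhX, GK, hx]
  have hf : f7hY.map φ = (X ^ 2 - X + 1) ^ 3
      - C y * (X * (X - 1) * (X ^ 3 - 8 * X ^ 2 + 5 * X + 1)) := by
    simp [f7hY, hy]
  have hs : t + (y - 13 - t) = y - 13 := by ring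
  have hp : t * (y - 13 - t) = 49 := by linear_combination -ht
  rw [hG, hf, res_G_f7 x y t (y - 13 - t) hs hp, Pt_mul x y t (y - 13 - t) hs hp]
  simp only [R7XY, map_mul, map_pow, map_sub, map_add, map_ofNat, ← hx, ← hy]
  ring
end
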